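/- arXiv:1712.05763 — 8 statements merged into one kernel-verified Lean document; each statement's English description precedes it below -/
import Mathlib

section
/- Fix an odd prime p, an integer g ≥ 2, h(x,z) ∈ F_p[x,z] homogeneous of degree 2g+1, and f = y²·z^(2g−1) − h(x,z) ∈ R = F_p[x,y,z]. For every r ≥ 1 and every basis monomial x^α (all exponents ≤ p^r − 1), the coefficient (f^(p^r−1))_α in the unique expansion of f^(p^r−1) over the R^(p^r)-basis of monomials has degree at most 1 in the variable y. In particular, no R-multiple of y² occurs among these canonical generators of I_r(f^(p^r−1)). -/
open MvPolynomial

/-- `rootIdeal q F` is the ideal `I_e(F)` of `q = p^e`-th roots of `F`: the smallest ideal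
`J` of `R` such that `F ∈ J^{[q]}`, the ideal generated by the `q`-th powers of the
elements of `J`. -/
noncomputable def rootIdeal {R : Type*} [CommRing R] (q : ℕ) (F : R) : Ideal R :=
  sInf {J : Ideal R | F ∈ Ideal.span ((fun a => a ^ q) '' (J : Set R))}

/-- The level of `F` in characteristic `p`: the least `s ≥ 1` with
`I_{s-1}(F^(p^(s-1)-1)) = I_s(F^(p^s-1))`. -/
noncomputable def level {R : Type*} [CommRing R] (p : ℕ) (F : R) : ℕ :=
  sInf {s : ℕ | 1 ≤ s ∧
    rootIdeal (p ^ (s - 1)) (F ^ (p ^ (s - 1) - 1)) = rootIdeal (p ^ s) (F ^ (p ^ s - 1))}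

theorem expand_pow_aux (p : ℕ) [Fact p.Prime] (r : ℕ) (φ : MvPolynomial (Fin 3) (ZMod p)) :
    φ ^ p ^ r = expand (p ^ r) φ := by
  induction r with
  | zero => simp
  | succ n ih => rw [pow_succ', expand_mul, ← ih, expand_zmod, ← pow_mul, mul_comm]

/-- In the expansion of `f^(p^r-1)` over the `R^(p^r)`-basis of monomials, every
coefficient has degree at most `1` in the variable `y`; in particular no `R`-multiple of
`y²` occurs among the canonical generators of `I_r(f^(p^r-1))`. -/
theorem statement1 (p : ℕ) (hp : p.Prime) (hodd : Odd p) (g : ℕ) (hg : 2 ≤ g)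
    (h : MvPolynomial (Fin 3) (ZMod p)) (hhom : h.IsHomogeneous (2 * g + 1))
    (hnoy : ∀ d ∈ h.support, d 1 = 0)
    (f : MvPolynomial (Fin 3) (ZMod p)) (hf : f = X 1 ^ 2 * X 2 ^ (2 * g - 1) - h)
    (r : ℕ) (hr : 1 ≤ r)
    (c : (Fin 3 → Fin (p ^ r)) → MvPolynomial (Fin 3) (ZMod p))
    (hc : f ^ (p ^ r - 1) =
      ∑ α : Fin 3 → Fin (p ^ r), c α ^ p ^ r * ∏ i, X i ^ (α i : ℕ)) :
    ∀ α, (c α).degreeOf 1 ≤ 1 := by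
  haveI : Fact p.Prime := ⟨hp⟩
  have hdf : f.degreeOf 1 ≤ 2 := by
    rw [hf]
    refine (degreeOf_sub_le _ _ _).trans (max_le ?_ ?_)
    · refine (degreeOf_mul_le _ _ _).trans ?_
      rw [degreeOf_X_self_pow, degreeOf_X_pow_of_ne _ (by decide)]
    · refine degreeOf_le_iff.mpr fun m hm => ?_
      rw [hnoy m hm]; omega
  have hq : 0 < p ^ r := pow_pos hp.pos r
  generalize hQ : p ^ r = q at *
  have hexp : ∀ φ : MvPolynomial (Fin 3) (ZMod p), φ ^ q = expand q φ := by
    intro φ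
    rw [← hQ]
    exact expand_pow_aux p r φ
  intro α
  refine degreeOf_le_iff.mpr fun d hd => ?_
  by_contra hlt
  rw [mem_support_iff] at hd
  let a : (Fin 3 → Fin q) → (Fin 3 →₀ ℕ) := fun β => Finsupp.equivFunOnFinite.symm fun i => (β i : ℕ)
  have ha : ∀ β i, a β i = (β i : ℕ) := fun β i => rfl
  have hmon : ∀ β : Fin 3 → Fin q, (∏ i, X i ^ (β i : ℕ) : MvPolynomial (Fin 3) (ZMod p)) = monomial (a β) 1 := by
    intro β
    rw [monomial_eq, C_1, one_mul, Finsupp.prod_fintype _ _ (by simp)]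
    rfl
  have key : coeff (q • d + a α) (f ^ (q - 1)) = coeff d (c α) := by
    rw [hc, coeff_sum, Finset.sum_eq_single α]
    · rw [hmon, hexp, coeff_mul_monomial, coeff_expand_smul _ hq.ne', mul_one]
    · intro β _ hβ
      rw [hmon, hexp, coeff_mul_monomial']
      split_ifs with hle
      · obtain ⟨i, hi⟩ := Function.ne_iff.mp hβ
        rw [mul_one]
        refine coeff_expand_of_not_dvd (i := i) _ ?_
        intro hdvd
        apply hi
        have h1 := hle i
        simp only [Finsupp.tsub_apply, Finsupp.add_apply, Finsupp.smul_apply, smul_eq_mul, ha] at hdvd h1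
        have h2 : (β i : ℕ) ≡ q * d i + α i [MOD q] := (Nat.modEq_iff_dvd' h1).mpr hdvd
        have h3 : (β i : ℕ) % q = (α i : ℕ) % q := by
          have := h2
          unfold Nat.ModEq at this
          rwa [Nat.mul_add_mod] at this
        rw [Nat.mod_eq_of_lt (β i).2, Nat.mod_eq_of_lt (α i).2] at h3
        exact Fin.ext h3
      · rfl
    · simp
  have hmem : q • d + a α ∈ (f ^ (q - 1)).support := by
    rw [mem_support_iff, key]; exact hd
  have hb := degreeOf_le_iff.mp ((degreeOf_pow_le 1 f (q - 1)).trans (Nat.mul_le_mul_left _ hdf)) _ hmem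
  simp only [Finsupp.add_apply, Finsupp.smul_apply, smul_eq_mul] at hb
  have : q * 2 ≤ q * d 1 := Nat.mul_le_mul_left _ (by omega)
  omega
end

section
/- Fix an odd prime p, an integer g ≥ 2, h(x,z) ∈ F_p[x,z] homogeneous of degree 2g+1, and f = y²·z^(2g−1) − h(x,z) ∈ R = F_p[x,y,z]. Let r ≥ 1 with p^r > 2g² − 1. Then for every basis monomial x^α, the coefficient (f^(p^r−1))_α in the unique expansion of f^(p^r−1) over the R^(p^r)-basis of monomials is not a nonzero scalar multiple of a monomial of the form x^a·y·z^b with a + b < 2g − 2. -/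
open MvPolynomial

theorem supp_pow {p g : ℕ} (hg : 2 ≤ g)
    (h : MvPolynomial (Fin 3) (ZMod p)) (hhom : h.IsHomogeneous (2 * g + 1))
    (hnoy : ∀ d ∈ h.support, d 1 = 0) (n : ℕ) :
    ∀ d ∈ ((X 1 ^ 2 * X 2 ^ (2 * g - 1) - h) ^ n).support,
      ∃ k m : ℕ, k + m = n ∧ d 1 = 2 * k ∧ d 0 ≤ (2 * g + 1) * m ∧
        d 0 + d 1 + d 2 = (2 * g + 1) * n := by
  classical
  induction n with
  | zero =>
    intro d hd
    rw [pow_zero, mem_support_iff, coeff_one] at hd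
    have : d = 0 := by
      by_contra hne
      exact hd (if_neg (fun h => hne h.symm))
    subst this
    exact ⟨0, 0, by simp⟩
  | succ n ih =>
    intro d hd
    rw [pow_succ] at hd
    obtain ⟨u, hu, v, hv, rfl⟩ := Finset.mem_add.1 (support_mul _ _ hd)
    obtain ⟨k, m, hkm, h1, h0, hs⟩ := ih u hu
    rcases Finset.mem_union.1 (support_sub _ _ _ hv) with hv | hv
    · have e : (X 1 ^ 2 * X 2 ^ (2 * g - 1) : MvPolynomial (Fin 3) (ZMod p))
          = monomial (Finsupp.single 1 2 + Finsupp.single 2 (2 * g - 1)) 1 := by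
        rw [X_pow_eq_monomial, X_pow_eq_monomial, monomial_mul, one_mul]
      rw [e] at hv
      have := Finset.mem_singleton.1 (support_monomial_subset hv)
      subst this
      refine ⟨k + 1, m, by omega, ?_, ?_, ?_⟩
      · simp; omega
      · simpa using h0
      · simp
        rw [mul_add]
        omega
    · have hv1 := hnoy v hv
      have hd : v.degree = 2 * g + 1 := by
        have h3 := hhom.degree_eq_sum_deg_support hv
        rw [h3, Finsupp.degree_apply]
      simp only [Finsupp.degree_eq_sum, Fin.sum_univ_three] at hd
      refine ⟨k, m + 1, by omega, ?_, ?_, ?_⟩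
      · simp; omega
      · simp
        rw [mul_add]
        omega
      · simp
        rw [mul_add]
        omega

theorem pow_eq_expand {p : ℕ} (hp : p.Prime) (r : ℕ) (c : MvPolynomial (Fin 3) (ZMod p)) :
    c ^ p ^ r = expand (p ^ r) c := by
  have := Fact.mk hp
  induction r with
  | zero => simp
  | succ r ih => rw [pow_succ, pow_mul, ih, ← expand_zmod, ← expand_mul, mul_comm]

theorem statement2 (p : ℕ) (hp : p.Prime) (hodd : Odd p) (g : ℕ) (hg : 2 ≤ g)
    (h : MvPolynomial (Fin 3) (ZMod p)) (hhom : h.IsHomogeneous (2 * g + 1))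
    (hnoy : ∀ d ∈ h.support, d 1 = 0)
    (f : MvPolynomial (Fin 3) (ZMod p)) (hf : f = X 1 ^ 2 * X 2 ^ (2 * g - 1) - h)
    (r : ℕ) (hr : 1 ≤ r) (hpr : 2 * g ^ 2 - 1 < p ^ r)
    (c : (Fin 3 → Fin (p ^ r)) → MvPolynomial (Fin 3) (ZMod p))
    (hc : f ^ (p ^ r - 1) =
      ∑ α : Fin 3 → Fin (p ^ r), c α ^ p ^ r * ∏ i, X i ^ (α i : ℕ)) :
    ∀ α (a b : ℕ), a + b < 2 * g - 2 → ∀ t : ZMod p, t ≠ 0 →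
      c α ≠ MvPolynomial.C t * (X 0 ^ a * X 1 * X 2 ^ b) := by
  classical
  intro α a b hab t ht hca
  have := Fact.mk hp
  have hq0 : p ^ r ≠ 0 := pow_ne_zero _ hp.ne_zero
  have hqodd : Odd (p ^ r) := hodd.pow
  generalize hA : (Finsupp.single 0 a + Finsupp.single 1 1 + Finsupp.single 2 b : Fin 3 →₀ ℕ) = A
  have hA0 : A 0 = a := by simp [← hA]
  have hA1 : A 1 = 1 := by simp [← hA]
  have hA2 : A 2 = b := by simp [← hA]
  have hca' : c α = monomial A t := by
    rw [hca, ← hA, X_pow_eq_monomial, X_pow_eq_monomial, X, monomial_mul, monomial_mul,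
      C_mul_monomial]
    simp
  have hprod : ∀ β : Fin 3 → Fin (p ^ r),
      (∏ i, X i ^ (β i : ℕ) : MvPolynomial (Fin 3) (ZMod p))
        = monomial (Finsupp.equivFunOnFinite.symm fun i => (β i : ℕ)) 1 := by
    intro β
    rw [monomial_eq, Finsupp.prod_fintype _ _ (by simp)]
    simp
  generalize hD : p ^ r • A + Finsupp.equivFunOnFinite.symm (fun i => (α i : ℕ)) = D
  have hDi : ∀ i, D i = p ^ r * A i + (α i : ℕ) := by intro i; simp [← hD]
  have hcoef : coeff D (f ^ (p ^ r - 1)) = t := by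
    rw [hc, coeff_sum, Finset.sum_eq_single α]
    · rw [hprod, pow_eq_expand hp, hca', ← hD, coeff_mul_monomial, coeff_expand_smul _ hq0]
      simp
    · intro β _ hne
      rw [hprod, pow_eq_expand hp, coeff_mul_monomial']
      split_ifs with hle
      · rw [mul_one]
        obtain ⟨i, hi⟩ := Function.ne_iff.1 hne
        apply coeff_expand_of_not_dvd (i := i)
        intro hdvd
        apply hi
        have hlei := hle i
        simp only [Finsupp.coe_tsub, Pi.sub_apply, Finsupp.equivFunOnFinite_symm_apply_apply] at hdvd hlei
        have h2 := (Nat.modEq_iff_dvd' hlei).2 hdvd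
        rw [hDi] at h2
        unfold Nat.ModEq at h2
        rw [Nat.mul_add_mod, Nat.mod_eq_of_lt (β i).2, Nat.mod_eq_of_lt (α i).2] at h2
        exact Fin.ext h2
      · rfl
    · simp
  have hmem : D ∈ (f ^ (p ^ r - 1)).support := by
    rw [mem_support_iff, hcoef]; exact ht
  rw [hf] at hmem
  obtain ⟨k, m, hkm, h1, h0, hs⟩ := supp_pow hg h hhom hnoy _ D hmem
  rw [hDi] at h0 h1
  rw [hDi, hDi, hDi] at hs
  rw [hA0] at h0 hs
  rw [hA1] at h1 hs
  rw [hA2] at hs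
  have l0 := (α 0).2
  have l1 := (α 1).2
  have l2 := (α 2).2
  generalize ((α 0 : Fin (p ^ r)) : ℕ) = x at *
  generalize ((α 1 : Fin (p ^ r)) : ℕ) = y at *
  generalize ((α 2 : Fin (p ^ r)) : ℕ) = z at *
  generalize p ^ r = q at *
  clear hc hcoef hmem hprod hDi hD hca hca' c α
  obtain ⟨G, rfl⟩ : ∃ G, g = G + 2 := ⟨g - 2, by omega⟩
  obtain ⟨Q, rfl⟩ : ∃ Q, q = Q + 1 := ⟨q - 1, by omega⟩
  obtain ⟨w, hw⟩ := hqodd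
  have hpr' : 2 * (G + 2) ^ 2 ≤ Q + 1 := by omega
  simp only [Nat.add_sub_cancel] at hs hkm
  have hab' : a + b ≤ 2 * G + 1 := by omega
  have hm1 : (Q + 1) * (a + b) ≤ (Q + 1) * (2 * G + 1) := Nat.mul_le_mul_left _ hab'
  have hsum : 3 * (Q + 1) ≤ x + y + z + 2 * G + 5 := by nlinarith
  have hm : m ≤ G := by omega
  have hm2 : (2 * (G + 2) + 1) * m ≤ (2 * (G + 2) + 1) * G := Nat.mul_le_mul_left _ hm
  have hxx : x ≤ (2 * (G + 2) + 1) * G := by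
    have := Nat.zero_le ((Q + 1) * a)
    omega
  nlinarith
end

section
/- Fix an odd prime p, an integer g ≥ 2, h(x,z) ∈ F_p[x,z] homogeneous of degree 2g+1, and f = y²·z^(2g−1) − h(x,z) ∈ R = F_p[x,y,z]. Let C be the Cartier–Manin matrix. If C ≠ 0 but C^g = 0 (by Nygaard's criteria this is the case exactly when the hyperelliptic curve y² = h(x,1) is supersingular but not superspecial), then the level of f is strictly greater than 2. -/
open MvPolynomial

/-- The trace-like operator. -/
noncomputable def trq (p q : ℕ) :
    MvPolynomial (Fin 3) (ZMod p) →ₗ[ZMod p] MvPolynomial (Fin 3) (ZMod p) :=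
  (basisMonomials (Fin 3) (ZMod p)).constr (ZMod p)
    (fun d => if ∀ i, d i % q = q - 1 then
      monomial (d.mapRange (fun n => n / q) (Nat.zero_div q)) 1 else 0)

noncomputable def cst (n : ℕ) : Fin 3 →₀ ℕ := Finsupp.equivFunOnFinite.symm (fun _ => n)

@[simp] theorem cst_apply (n : ℕ) (i : Fin 3) : cst n i = n := rfl

theorem trq_monomial (p q : ℕ) (d : Fin 3 →₀ ℕ) (c : ZMod p) :
    trq p q (monomial d c) = if ∀ i, d i % q = q - 1 then
      monomial (d.mapRange (fun n => n / q) (Nat.zero_div q)) c else 0 := by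
  have : monomial d c = c • (basisMonomials (Fin 3) (ZMod p)) d := by
    simp [smul_monomial]
  rw [this, map_smul, trq, Module.Basis.constr_basis]
  split_ifs <;> simp [smul_monomial]

theorem coeff_trq (p q : ℕ) (hq : 0 < q) (r : MvPolynomial (Fin 3) (ZMod p)) (m : Fin 3 →₀ ℕ) :
    coeff m (trq p q r) = coeff (q • m + cst (q - 1)) r := by
  induction r using MvPolynomial.induction_on' with
  | monomial d c =>
    rw [trq_monomial, coeff_monomial]
    split_ifs with h1 h2 h2
    · rw [coeff_monomial, if_pos]
      ext i
      have h3 := congrArg (fun e => e i) h2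
      have h4 := h1 i
      simp at h3 
      simp [h3] at h4
      simp [h3]
      rw [Nat.mul_add_div hq, Nat.div_eq_of_lt (by omega)]; rfl
    · rw [coeff_monomial, if_neg]
      rintro rfl
      apply h2
      ext i
      have h4 := h1 i
      simp
      rw [← h4]
      exact (Nat.div_add_mod _ _).symm
    · exfalso; apply h1
      intro i
      have h3 := congrArg (fun e => e i) h2
      simp at h3 
      rw [h3, Nat.mul_add_mod, Nat.mod_eq_of_lt (by omega)]
    · simp
  | add a b ha hb => simp [ha, hb]

theorem trq_trq (p q q' : ℕ) (hq : 0 < q) (hq' : 0 < q') (r : MvPolynomial (Fin 3) (ZMod p)) :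
    trq p q' (trq p q r) = trq p (q * q') r := by
  ext m
  rw [coeff_trq _ _ hq', coeff_trq _ _ hq, coeff_trq _ _ (Nat.mul_pos hq hq')]
  congr 1
  ext i
  simp
  obtain ⟨a, rfl⟩ := Nat.exists_eq_succ_of_ne_zero hq.ne'
  obtain ⟨b, rfl⟩ := Nat.exists_eq_succ_of_ne_zero hq'.ne'
  have : a.succ * b.succ = a * b + a + b + 1 := by rw [Nat.succ_eq_add_one, Nat.succ_eq_add_one]; ring
  simp only [this]
  simp
  ring

theorem trq_pow_mul (p e : ℕ) [Fact p.Prime] (a r : MvPolynomial (Fin 3) (ZMod p)) :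
    trq p (p ^ e) (a ^ (p ^ e) * r) = a * trq p (p ^ e) r := by
  have hq : 0 < p ^ e := pow_pos (Fact.out : p.Prime).pos e
  induction a using MvPolynomial.induction_on' with
  | monomial d c =>
    rw [monomial_pow, ZMod.pow_card_pow]
    ext m
    rw [coeff_trq _ _ hq, coeff_monomial_mul', coeff_monomial_mul', coeff_trq _ _ hq]
    have h : p ^ e • d ≤ p ^ e • m + cst (p ^ e - 1) ↔ d ≤ m := by
      rw [Finsupp.le_def, Finsupp.le_def]
      refine forall_congr' fun i => ?_
      simp
      constructor
      · intro h
        by_contra h'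
        have : p ^ e * (m i + 1) ≤ p ^ e * d i := Nat.mul_le_mul_left _ (by omega)
        rw [mul_add] at this
        omega
      · intro h
        have := Nat.mul_le_mul_left (p ^ e) h
        omega
    by_cases hd : d ≤ m
    · rw [if_pos hd, if_pos (h.2 hd)]
      congr 2
      ext i
      have := hd i
      simp
      rw [Nat.mul_sub]
      have := Nat.mul_le_mul_left (p ^ e) this
      omega
    · rw [if_neg hd, if_neg (fun h' => hd (h.1 h'))]
  | add a b ha hb =>
    rw [add_pow_char_pow, add_mul, map_add, ha, hb, add_mul]

noncomputable def mn (p : ℕ) {q : ℕ} (a : Fin 3 → Fin q) : MvPolynomial (Fin 3) (ZMod p) :=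
  monomial (Finsupp.equivFunOnFinite.symm (fun i => (a i : ℕ))) 1

theorem decomp (p e : ℕ) [Fact p.Prime] (F : MvPolynomial (Fin 3) (ZMod p)) :
    F = ∑ a : Fin 3 → Fin (p ^ e),
      (trq p (p ^ e) (F * mn p (fun i => (a i).rev))) ^ (p ^ e) * mn p a := by
  have hq : 0 < p ^ e := pow_pos (Fact.out : p.Prime).pos e
  induction F using MvPolynomial.induction_on' with
  | monomial d c =>
    rw [Finset.sum_eq_single (fun i => ⟨d i % p ^ e, Nat.mod_lt _ hq⟩)]
    · rw [mn, mn, monomial_mul, trq_monomial, if_pos, monomial_pow, monomial_mul]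
      · rw [mul_one, mul_one, ZMod.pow_card_pow]
        refine congrArg (fun t => monomial t c) ?_
        ext i
        have h1 := Nat.mod_lt (d i) hq
        have h2 := Nat.div_add_mod (d i) (p ^ e)
        simp [Fin.rev]
        have : d i + (p ^ e - (d i % p ^ e + 1)) = p ^ e * (d i / p ^ e) + (p ^ e - 1) := by omega
        rw [this, Nat.mul_add_div hq, Nat.div_eq_of_lt (show p ^ e - 1 < p ^ e by omega)]
        simp [h2]
      · intro i
        have h1 := Nat.mod_lt (d i) hq
        have h2 := Nat.div_add_mod (d i) (p ^ e)
        simp [Fin.rev]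
        have : d i + (p ^ e - (d i % p ^ e + 1)) = p ^ e * (d i / p ^ e) + (p ^ e - 1) := by omega
        rw [this, Nat.mul_add_mod, Nat.mod_eq_of_lt (by omega)]
    · intro a _ ha
      rw [mn, monomial_mul, trq_monomial, if_neg, zero_pow hq.ne', zero_mul]
      intro h
      apply ha
      ext i
      have h1 := h i
      have ha := (a i).isLt
      simp [Fin.rev] at h1
      have h2 := Nat.div_add_mod (d i + (p ^ e - (a i + 1))) (p ^ e)
      rw [h1] at h2
      set t := (d i + (p ^ e - (↑(a i) + 1))) / p ^ e
      have h3 : d i = p ^ e * t + a i := by omega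
      simp
      rw [h3, Nat.mul_add_mod, Nat.mod_eq_of_lt ha]
    · simp
  | add a b ha hb =>
    conv_lhs => rw [ha, hb]
    rw [← Finset.sum_add_distrib]
    refine Finset.sum_congr rfl fun i _ => ?_
    rw [← add_mul, ← add_pow_char_pow, ← map_add, ← add_mul]

theorem trq_mem_span (p e : ℕ) [Fact p.Prime] (F r : MvPolynomial (Fin 3) (ZMod p)) :
    trq p (p ^ e) (F * r) ∈ Ideal.span (Set.range fun a : Fin 3 → Fin (p ^ e) =>
      trq p (p ^ e) (F * mn p a)) := by
  rw [decomp p e r, Finset.mul_sum, map_sum]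
  refine Ideal.sum_mem _ fun a _ => ?_
  rw [mul_left_comm, trq_pow_mul]
  exact Ideal.mul_mem_left _ _ (Ideal.subset_span ⟨a, rfl⟩)

theorem mem_rootIdeal (p e : ℕ) [Fact p.Prime] (F x : MvPolynomial (Fin 3) (ZMod p)) :
    x ∈ rootIdeal (p ^ e) F ↔ ∃ r, trq p (p ^ e) (F * r) = x := by
  constructor
  · intro hx
    let K : Ideal (MvPolynomial (Fin 3) (ZMod p)) :=
      { carrier := {x | ∃ r, trq p (p ^ e) (F * r) = x}
        add_mem' := by
          rintro _ _ ⟨r, rfl⟩ ⟨s, rfl⟩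
          exact ⟨r + s, by rw [mul_add, map_add]⟩
        zero_mem' := ⟨0, by simp⟩
        smul_mem' := by
          rintro c _ ⟨r, rfl⟩
          exact ⟨c ^ p ^ e * r, by rw [mul_left_comm, trq_pow_mul, smul_eq_mul]⟩ }
    have hK : F ∈ Ideal.span ((fun a => a ^ (p ^ e)) '' (K : Set _)) := by
      rw [decomp p e F]
      refine Ideal.sum_mem _ fun a _ => ?_
      refine Ideal.mul_mem_right _ _ (Ideal.subset_span ?_)
      exact ⟨_, ⟨_, rfl⟩, rfl⟩
    exact (sInf_le hK : rootIdeal (p ^ e) F ≤ K) hx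
  · rintro ⟨r, rfl⟩
    rw [rootIdeal, Ideal.mem_sInf]
    intro J hJ
    have hJ : F ∈ Ideal.span ((fun a => a ^ (p ^ e)) '' (J : Set _)) := hJ
    have h2 := Ideal.mul_mem_right r _ hJ
    refine Submodule.span_induction (p := fun y _ => ∀ s, trq p (p ^ e) (y * s) ∈ J)
      ?_ ?_ ?_ ?_ hJ r
    · rintro _ ⟨a, ha, rfl⟩ s
      rw [trq_pow_mul]
      exact J.mul_mem_right _ ha
    · simp
    · intro x y _ _ hx hy s
      rw [add_mul, map_add]
      exact J.add_mem (hx s) (hy s)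
    · intro c x _ hx s
      rw [smul_eq_mul, mul_assoc, mul_left_comm]
      exact hx _

theorem deg_eq (d : Fin 3 →₀ ℕ) : d.degree = d 0 + d 1 + d 2 := by
  rw [Finsupp.degree_eq_sum, Fin.sum_univ_three]

theorem sum_eq_deg (d : Fin 3 →₀ ℕ) : (d.sum fun _ e => e) = d 0 + d 1 + d 2 := by
  rw [Finsupp.sum_fintype _ _ (by simp), Fin.sum_univ_three]

theorem iter_trq (p e : ℕ) [Fact p.Prime] (f r : MvPolynomial (Fin 3) (ZMod p)) :
    trq p (p ^ (e + 1)) (f ^ (p ^ (e + 1) - 1) * r) =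
      trq p (p ^ e) (f ^ (p ^ e - 1) * trq p p (f ^ (p - 1) * r)) := by
  have hp : 0 < p := (Fact.out : p.Prime).pos
  have hq : 0 < p ^ e := pow_pos hp e
  have h1 : p ^ (e + 1) = p * p ^ e := by ring
  have h2 : p * p ^ e - 1 = (p ^ e - 1) * p + (p - 1) := by
    obtain ⟨b, hb⟩ := Nat.exists_eq_succ_of_ne_zero hq.ne'
    rw [hb, Nat.succ_eq_add_one, Nat.add_sub_cancel]
    rw [mul_add, mul_comm]
    omega
  have h3 := trq_pow_mul p 1 (f ^ (p ^ e - 1)) (f ^ (p - 1) * r)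
  rw [pow_one] at h3
  rw [← h3, trq_trq _ _ _ hp hq, h1, h2, pow_add, pow_mul, mul_assoc]

theorem totalDegree_trq (p q D : ℕ) (hq : 0 < q) (G : MvPolynomial (Fin 3) (ZMod p))
    (hG : G.totalDegree ≤ (q - 1) * D + 3 * (q - 1)) : (trq p q G).totalDegree ≤ D := by
  rw [totalDegree]
  refine Finset.sup_le fun m hm => ?_
  rw [mem_support_iff, coeff_trq _ _ hq, ← mem_support_iff] at hm
  have h1 := (le_totalDegree hm).trans hG
  rw [sum_eq_deg] at h1 ⊢
  simp at h1
  have h2 : q * (m 0 + m 1 + m 2) ≤ (q - 1) * D := by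
    rw [mul_add, mul_add]; omega
  have h3 : (q - 1) * D ≤ q * D := Nat.mul_le_mul_right _ (by omega)
  exact Nat.le_of_mul_le_mul_left (h2.trans h3) hq

theorem finite_deg (p D : ℕ) [Fact p.Prime] :
    {x : MvPolynomial (Fin 3) (ZMod p) | x.totalDegree ≤ D}.Finite := by
  have h : Finite (restrictTotalDegree (Fin 3) (ZMod p) D) :=
    Module.finite_of_finite (ZMod p)
  have h2 := Set.toFinite (restrictTotalDegree (Fin 3) (ZMod p) D : Set (MvPolynomial (Fin 3) (ZMod p)))
  refine h2.subset fun x hx => ?_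
  exact (mem_restrictTotalDegree _ _ _).2 hx

theorem exists_stab (p : ℕ) [Fact p.Prime] (f : MvPolynomial (Fin 3) (ZMod p)) :
    ∃ s, rootIdeal (p ^ s) (f ^ (p ^ s - 1)) = rootIdeal (p ^ (s + 1)) (f ^ (p ^ (s + 1) - 1)) := by
  by_contra! hne
  set I : ℕ → Ideal (MvPolynomial (Fin 3) (ZMod p)) :=
    fun s => rootIdeal (p ^ s) (f ^ (p ^ s - 1)) with hI
  have hle : ∀ s, I (s + 1) ≤ I s := by
    intro s x hx
    rw [hI] at hx ⊢
    simp only [mem_rootIdeal] at hx ⊢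
    obtain ⟨r, rfl⟩ := hx
    exact ⟨_, (iter_trq p s f r).symm⟩
  set W : ℕ → Set (MvPolynomial (Fin 3) (ZMod p)) :=
    fun s => {x | x ∈ I s ∧ x.totalDegree ≤ f.totalDegree} with hW
  have hfin : ∀ s, (W s).Finite := fun s =>
    (finite_deg p f.totalDegree).subset fun x hx => hx.2
  have hlt : ∀ s, (W (s + 1)).ncard < (W s).ncard := by
    intro s
    refine Set.ncard_lt_ncard ⟨fun x hx => ⟨hle s hx.1, hx.2⟩, fun hsub => hne s ?_⟩ (hfin s)
    refine le_antisymm ?_ (hle s)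
    intro x hx
    rw [mem_rootIdeal] at hx
    obtain ⟨r, rfl⟩ := hx
    refine (Ideal.span_le.2 ?_) (trq_mem_span p s _ r)
    rintro _ ⟨a, rfl⟩
    refine (hsub (a := trq p (p ^ s) (f ^ (p ^ s - 1) * mn p a)) ⟨?_, ?_⟩).1
    · exact (mem_rootIdeal _ _ _ _).2 ⟨_, rfl⟩
    · apply totalDegree_trq
      · exact pow_pos (Fact.out : p.Prime).pos s
      · refine (totalDegree_mul _ _).trans (add_le_add (totalDegree_pow _ _) ?_)
        rw [mn]
        refine (totalDegree_monomial_le _ _).trans ((sum_eq_deg _).le.trans ?_)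
        have h0 := (a 0).isLt
        have h1 := (a 1).isLt
        have h2 := (a 2).isLt
        simp
        omega
  have : ∀ s, (W s).ncard + s ≤ (W 0).ncard := by
    intro s
    induction s with
    | zero => simp
    | succ n ih => have := hlt n; omega
  have := this ((W 0).ncard + 1)
  omega

theorem hc_trq (p n : ℕ) (hp : 0 < p) (s : MvPolynomial (Fin 3) (ZMod p)) :
    homogeneousComponent n (trq p p s) =
      trq p p (homogeneousComponent (p * n + 3 * (p - 1)) s) := by
  ext m
  rw [coeff_homogeneousComponent, coeff_trq _ _ hp, coeff_trq _ _ hp, coeff_homogeneousComponent]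
  refine if_congr ?_ rfl rfl
  rw [deg_eq, deg_eq]
  simp
  rw [show p * m 0 + (p - 1) + (p * m 1 + (p - 1)) + (p * m 2 + (p - 1)) =
    p * (m 0 + m 1 + m 2) + 3 * (p - 1) by ring]
  rw [Nat.add_right_cancel_iff, Nat.mul_right_inj hp.ne']

theorem hc_mul (p a n : ℕ) (F r : MvPolynomial (Fin 3) (ZMod p)) (hF : F.IsHomogeneous a) :
    homogeneousComponent (a + n) (F * r) = F * homogeneousComponent n r := by
  conv_lhs => rw [← sum_homogeneousComponent r]
  rw [Finset.mul_sum, map_sum]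
  have : ∀ i, homogeneousComponent (a + n) (F * homogeneousComponent i r) =
      if i = n then F * homogeneousComponent n r else 0 := by
    intro i
    rw [homogeneousComponent_of_mem (hF.mul (homogeneousComponent_isHomogeneous i r))]
    by_cases h : i = n
    · subst h; simp
    · rw [if_neg (by omega), if_neg h]
  simp only [this]
  rw [Finset.sum_ite_eq']
  split_ifs with h
  · rfl
  · rw [homogeneousComponent_eq_zero, mul_zero]
    simp at h; omega

theorem level_core (p g : ℕ) [Fact p.Prime] (hg : 2 ≤ g) (f : MvPolynomial (Fin 3) (ZMod p))
    (hf : f.IsHomogeneous (2 * g + 1))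
    (v w : MvPolynomial (Fin 3) (ZMod p)) (hw : w.IsHomogeneous (2 * g - 2))
    (hv : v = trq p p (f ^ (p - 1) * w)) (hv0 : v ≠ 0) (N : ℕ)
    (hN : (fun r => trq p p (f ^ (p - 1) * r))^[N] v = 0) : 2 < level p f := by
  have hp : 0 < p := (Fact.out : p.Prime).pos
  set φ : MvPolynomial (Fin 3) (ZMod p) → MvPolynomial (Fin 3) (ZMod p) :=
    fun r => trq p p (f ^ (p - 1) * r) with hφ
  have hφ0 : ∀ a b, φ (a - b) = φ a - φ b := fun a b => by simp only [hφ, mul_sub, map_sub]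
  have hphi0 : φ 0 = 0 := by simp [hφ]
  have hhc : ∀ r, homogeneousComponent (2 * g - 2) (φ r) = φ (homogeneousComponent (2 * g - 2) r) := by
    intro r
    rw [hφ]
    simp only
    rw [hc_trq _ _ hp, ← hc_mul _ _ _ _ _ (hf.pow (p - 1))]
    congr 3
    obtain ⟨b, rfl⟩ := Nat.exists_eq_succ_of_ne_zero hp.ne'
    obtain ⟨c, rfl⟩ : ∃ c, g = c + 2 := ⟨g - 2, by omega⟩
    rw [show 2 * (c + 2) - 2 = 2 * c + 2 by omega]
    simp
    ring
  have h1 : ∀ x, x ∈ rootIdeal (p ^ 1) (f ^ (p ^ 1 - 1)) ↔ ∃ r, φ r = x := by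
    intro x; rw [mem_rootIdeal, pow_one]
  have h2 : ∀ x, x ∈ rootIdeal (p ^ 2) (f ^ (p ^ 2 - 1)) ↔ ∃ r, φ (φ r) = x := by
    intro x; rw [mem_rootIdeal]
    have := iter_trq p 1 f
    rw [pow_one] at this
    simp only [hφ]
    refine exists_congr fun r => ?_
    rw [← this]
  have key : ¬ ∀ r, ∃ r', φ (φ r') = φ r := by
    intro H
    set A : Set (MvPolynomial (Fin 3) (ZMod p)) :=
      {x | ∃ r, r.IsHomogeneous (2 * g - 2) ∧ φ r = x} with hA
    have hAh : ∀ x ∈ A, x.IsHomogeneous (2 * g - 2) := by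
      rintro _ ⟨r, hr, rfl⟩
      rw [← homogeneousComponent_eq_self hr, ← hhc]
      exact homogeneousComponent_isHomogeneous _ _
    have hfin : A.Finite := (finite_deg p (2 * g - 2)).subset fun x hx =>
      (hAh x hx).totalDegree_le
    have hmaps : Set.MapsTo φ A A := fun x hx => ⟨x, hAh x hx, rfl⟩
    have hsurj : Set.SurjOn φ A A := by
      rintro _ ⟨r, hr, rfl⟩
      obtain ⟨r', hr'⟩ := H r
      refine ⟨φ (homogeneousComponent (2 * g - 2) r'),
        ⟨_, homogeneousComponent_isHomogeneous _ _, rfl⟩, ?_⟩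
      rw [← hhc, ← hhc, hr', hhc, homogeneousComponent_eq_self hr]
    have hinj : Set.InjOn φ A := by
      have : Finite A := hfin
      have hs : Function.Surjective (hmaps.restrict) := (Set.MapsTo.restrict_surjective_iff hmaps).2 hsurj
      exact (Set.MapsTo.restrict_inj hmaps).1 (Finite.injective_iff_surjective.2 hs)
    have h0 : (0 : MvPolynomial (Fin 3) (ZMod p)) ∈ A := ⟨0, isHomogeneous_zero _ _ _, hphi0⟩
    have : ∀ N, ∀ x ∈ A, φ^[N] x = 0 → x = 0 := by
      intro N
      induction N with
      | zero => intro x _ h; exact h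
      | succ n ih =>
        intro x hx h
        rw [Function.iterate_succ_apply] at h
        exact hinj hx h0 ((ih _ (hmaps hx) h).trans hphi0.symm)
    exact hv0 (this N v ⟨w, hw, hv.symm⟩ hN)
  have key2 : rootIdeal (p ^ 1) (f ^ (p ^ 1 - 1)) ≠ rootIdeal (p ^ 2) (f ^ (p ^ 2 - 1)) := by
    intro H
    apply key
    intro r
    rw [← h2, ← H, h1]
    exact ⟨r, rfl⟩
  have key1 : rootIdeal (p ^ 0) (f ^ (p ^ 0 - 1)) ≠ rootIdeal (p ^ 1) (f ^ (p ^ 1 - 1)) := by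
    intro H
    apply key
    have hall : ∀ x, ∃ r, φ r = x := by
      intro x
      rw [← h1, ← H, rootIdeal, Ideal.mem_sInf]
      intro J hJ
      have hJ : (f ^ (p ^ 0 - 1)) ∈ Ideal.span ((fun a => a ^ (p ^ 0)) '' (J : Set _)) := hJ
      simp at hJ
      rw [(Ideal.eq_top_iff_one J).2 hJ]; trivial
    intro r
    obtain ⟨s, hs⟩ := hall r
    exact ⟨s, by rw [hs]⟩
  have hne : {s : ℕ | 1 ≤ s ∧
    rootIdeal (p ^ (s - 1)) (f ^ (p ^ (s - 1) - 1)) = rootIdeal (p ^ s) (f ^ (p ^ s - 1))}.Nonempty := by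
    obtain ⟨s, hs⟩ := exists_stab p f
    exact ⟨s + 1, by omega, by simpa using hs⟩
  have hmem := Nat.sInf_mem hne
  change 1 ≤ level p f ∧ rootIdeal (p ^ (level p f - 1)) (f ^ (p ^ (level p f - 1) - 1)) =
    rootIdeal (p ^ (level p f)) (f ^ (p ^ (level p f) - 1)) at hmem
  obtain ⟨ha, hb⟩ := hmem
  by_contra hcon
  have : level p f = 1 ∨ level p f = 2 := by omega
  rcases this with h | h
  · rw [h] at hb; exact key1 hb
  · rw [h] at hb; exact key2 hb

noncomputable def tri (a b c : ℕ) : Fin 3 →₀ ℕ := Finsupp.equivFunOnFinite.symm ![a, b, c]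

@[simp] theorem tri_0 (a b c : ℕ) : tri a b c 0 = a := rfl
@[simp] theorem tri_1 (a b c : ℕ) : tri a b c 1 = b := rfl
@[simp] theorem tri_2 (a b c : ℕ) : tri a b c 2 = c := rfl

theorem tri_ext (d : Fin 3 →₀ ℕ) (a b c : ℕ) : tri a b c = d ↔ a = d 0 ∧ b = d 1 ∧ c = d 2 := by
  constructor
  · rintro rfl; simp
  · rintro ⟨h0, h1, h2⟩
    ext i
    fin_cases i
    · exact h0
    · exact h1
    · exact h2

theorem tri_add (a b c a' b' c' : ℕ) : tri a b c + tri a' b' c' = tri (a + a') (b + b') (c + c') := by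
  symm; rw [tri_ext]; simp

theorem noy_pow (p : ℕ) (h : MvPolynomial (Fin 3) (ZMod p))
    (hnoy : ∀ d ∈ h.support, d 1 = 0) (n : ℕ) (d : Fin 3 →₀ ℕ) (hd : d 1 ≠ 0) :
    coeff d (h ^ n) = 0 := by
  by_contra hc
  have h1 := monomial_le_degreeOf 1 (mem_support_iff.2 hc)
  have h2 := degreeOf_pow_le 1 h n
  have h3 : degreeOf 1 h = 0 := by
    rw [degreeOf_eq_sup]
    exact Nat.le_zero.1 (Finset.sup_le fun d hd => (hnoy d hd).le)
  rw [h3] at h2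
  omega

theorem trq_noy (p : ℕ) (hp : 0 < p) (G : MvPolynomial (Fin 3) (ZMod p))
    (hG : ∀ d : Fin 3 →₀ ℕ, d 1 ≠ 0 → coeff d G = 0) (s : Fin 3 →₀ ℕ) (c : ZMod p)
    (hs : s 1 % p ≠ p - 1) : trq p p (G * monomial s c) = 0 := by
  ext m
  rw [coeff_trq _ _ hp, coeff_mul_monomial']
  split_ifs with h
  · rw [hG, zero_mul, coeff_zero]
    have h1 := h 1
    simp at h1 ⊢
    intro h2
    apply hs
    have : s 1 = p * m 1 + (p - 1) := by omega
    rw [this, Nat.mul_add_mod, Nat.mod_eq_of_lt (by omega)]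
  · simp

theorem expand_f (p g : ℕ) [Fact p.Prime] (hodd : Odd p) (h : MvPolynomial (Fin 3) (ZMod p))
    (hnoy : ∀ d ∈ h.support, d 1 = 0) (a b c k0 : ℕ) (hk0 : k0 ≤ p - 1)
    (hk : (2 * k0 + b) % p = p - 1) :
    trq p p ((X 1 ^ 2 * X 2 ^ (2 * g - 1) - h) ^ (p - 1) * monomial (tri a b c) 1) =
    trq p p (h ^ (p - 1 - k0) * monomial (tri a (2 * k0 + b) ((2 * g - 1) * k0 + c))
      ((-1) ^ (p - 1 - k0) * ((p - 1).choose k0 : ZMod p))) := by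
  have hp : p.Prime := Fact.out
  have hX : (X 1 ^ 2 * X 2 ^ (2 * g - 1) : MvPolynomial (Fin 3) (ZMod p)) =
      monomial (tri 0 2 (2 * g - 1)) 1 := by
    rw [X_pow_eq_monomial, X_pow_eq_monomial, monomial_mul, one_mul]
    refine congrArg (fun t => monomial t _) ?_
    symm
    rw [tri_ext]
    simp [Finsupp.single_apply]
  have hterm : ∀ k, (X 1 ^ 2 * X 2 ^ (2 * g - 1)) ^ k * (-h) ^ (p - 1 - k) *
      ((p - 1).choose k : MvPolynomial (Fin 3) (ZMod p)) * monomial (tri a b c) 1 =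
      h ^ (p - 1 - k) * monomial (tri a (2 * k + b) ((2 * g - 1) * k + c))
      ((-1) ^ (p - 1 - k) * ((p - 1).choose k : ZMod p)) := by
    intro k
    have e1 : monomial (tri a (2 * k + b) ((2 * g - 1) * k + c))
        ((-1) ^ (p - 1 - k) * ((p - 1).choose k : ZMod p)) =
        (monomial (tri 0 2 (2 * g - 1)) (1 : ZMod p)) ^ k * monomial (tri a b c) 1 *
        C ((-1) ^ (p - 1 - k) * ((p - 1).choose k : ZMod p)) := by
      rw [monomial_pow, monomial_mul, mul_comm _ (C _), C_mul_monomial]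
      simp only [one_pow, mul_one]
      refine congrArg (fun t => monomial t _) ?_
      rw [tri_ext]
      simp [mul_comm]
    rw [hX, e1, neg_pow h]
    simp only [map_mul, map_pow, map_neg, map_one, map_natCast]
    ring
  rw [sub_eq_add_neg, add_pow, Finset.sum_mul, map_sum]
  simp only [hterm]
  apply Finset.sum_eq_single_of_mem k0 (by simp; omega)
  intro k hkr hkk
  apply trq_noy p hp.pos
  · exact fun d hd => noy_pow p h hnoy _ d hd
  · simp
    intro hk'
    apply hkk
    have h1 : 2 * k + b ≡ 2 * k0 + b [MOD p] := hk'.trans hk.symm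
    have h2 : 2 * k ≡ 2 * k0 [MOD p] := Nat.ModEq.add_right_cancel' b h1
    have h3 : k ≡ k0 [MOD p] := Nat.ModEq.cancel_left_of_coprime
      (by rw [← Nat.Coprime]; exact Nat.coprime_two_right.2 hodd) h2
    have hlt : k < p - 1 + 1 := Finset.mem_range.1 hkr
    have := hp.pos
    exact Nat.ModEq.eq_of_lt_of_lt h3 (by omega) (by omega)

theorem case_small (p g : ℕ) [Fact p.Prime] (hodd : Odd p) (hg : 2 ≤ g)
    (h : MvPolynomial (Fin 3) (ZMod p))
    (hnoy : ∀ d ∈ h.support, d 1 = 0) (hpg : p + 2 ≤ 2 * g)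
    (hf : (X 1 ^ 2 * X 2 ^ (2 * g - 1) - h).IsHomogeneous (2 * g + 1)) :
    2 < level p (X 1 ^ 2 * X 2 ^ (2 * g - 1) - h) := by
  have hp : p.Prime := Fact.out
  have hp2 := hp.two_le
  have hmod : (2 * (p - 1) + 1) % p = p - 1 := by
    rw [show 2 * (p - 1) + 1 = p * 1 + (p - 1) by omega, Nat.mul_add_mod, Nat.mod_eq_of_lt (by omega)]
  have e1 : trq p p ((X 1 ^ 2 * X 2 ^ (2 * g - 1) - h) ^ (p - 1) *
      monomial (tri (p - 1) 1 (2 * g - 2 - p)) 1) = monomial (tri 0 1 (2 * g - 3)) 1 := by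
    rw [expand_f p g hodd h hnoy _ _ _ (p - 1) le_rfl hmod]
    have h2 : (2 * g - 1) * (p - 1) + (2 * g - 2 - p) = p * (2 * g - 3) + (p - 1) := by
      obtain ⟨t, ht⟩ := Nat.exists_eq_add_of_le hpg
      obtain ⟨b, rfl⟩ := Nat.exists_eq_succ_of_ne_zero hp.pos.ne'
      rw [ht, show b.succ + 2 + t - 1 = b + 2 + t by omega,
        show b.succ + 2 + t - 3 = b + t by omega, show b.succ + 2 + t - 2 - b.succ = t by omega]
      simp
      ring
    rw [h2]
    simp
    rw [trq_monomial, if_pos]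
    · refine congrArg (fun t => monomial t _) ?_
      symm
      rw [tri_ext]
      simp
      refine ⟨?_, ?_, ?_⟩
      · rw [Nat.div_eq_of_lt (by omega)]
      · rw [show 2 * (p - 1) + 1 = p * 1 + (p - 1) by omega, Nat.mul_add_div hp.pos,
          Nat.div_eq_of_lt (by omega)]
      · rw [Nat.mul_add_div hp.pos, Nat.div_eq_of_lt (show p - 1 < p by omega)]; rfl
    · intro i
      fin_cases i
      · exact Nat.mod_eq_of_lt (show p - 1 < p by omega)
      · exact hmod
      · change (p * (2 * g - 3) + (p - 1)) % p = _
        rw [Nat.mul_add_mod, Nat.mod_eq_of_lt (by omega)]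
  have e2 : trq p p ((X 1 ^ 2 * X 2 ^ (2 * g - 1) - h) ^ (p - 1) *
      monomial (tri 0 1 (2 * g - 3)) 1) = 0 := by
    rw [expand_f p g hodd h hnoy _ _ _ (p - 1) le_rfl hmod]
    simp
    rw [trq_monomial, if_neg]
    intro hi
    have := hi 0
    simp at this
    omega
  refine level_core p g hg _ hf (monomial (tri 0 1 (2 * g - 3)) 1)
    (monomial (tri (p - 1) 1 (2 * g - 2 - p)) 1) ?_ e1.symm (by simp) 1 ?_
  · apply isHomogeneous_monomial
    rw [deg_eq]; simp; omega
  · simpa using e2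

theorem coeff_aeval (p N : ℕ) (H : MvPolynomial (Fin 3) (ZMod p)) (hH : H.IsHomogeneous N)
    (hy : ∀ d : Fin 3 →₀ ℕ, d 1 ≠ 0 → coeff d H = 0) (n : ℕ) :
    (MvPolynomial.aeval ![Polynomial.X, 0, 1] H : Polynomial (ZMod p)).coeff n =
      if n ≤ N then coeff (tri n 0 (N - n)) H else 0 := by
  have h1 : ∀ d ∈ H.support, d 1 = 0 ∧ d 0 + d 2 = N := by
    intro d hd
    rw [mem_support_iff] at hd
    have h2 : d 1 = 0 := by by_contra h; exact hd (hy d h)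
    have h3 : d.degree = N := by by_contra h; exact hd (hH.coeff_eq_zero h)
    rw [deg_eq] at h3
    exact ⟨h2, by omega⟩
  conv_lhs => rw [H.as_sum]
  rw [map_sum, Polynomial.finsetSum_coeff]
  have h4 : ∀ d ∈ H.support, (MvPolynomial.aeval ![Polynomial.X, 0, 1] (monomial d (coeff d H)) :
      Polynomial (ZMod p)).coeff n = if n = d 0 then coeff d H else 0 := by
    intro d hd
    rw [aeval_monomial, Finsupp.prod_fintype _ _ (by simp), Fin.prod_univ_three]
    simp [(h1 d hd).1, Polynomial.coeff_X_pow]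
  rw [Finset.sum_congr rfl h4]
  split_ifs with hn
  · rw [Finset.sum_eq_single (tri n 0 (N - n))]
    · simp
    · intro d hd hne
      rw [if_neg]
      rintro rfl
      apply hne
      symm
      rw [tri_ext]
      have := h1 d hd
      omega
    · intro hns
      simpa using hns
  · refine Finset.sum_eq_zero fun d hd => ?_
    rw [if_neg]
    have := h1 d hd
    omega

theorem phi_w (p g : ℕ) [Fact p.Prime] (hodd : Odd p) (hg : 2 ≤ g) (hpg : g ≤ p)
    (h : MvPolynomial (Fin 3) (ZMod p)) (hhom : h.IsHomogeneous (2 * g + 1))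
    (hnoy : ∀ d ∈ h.support, d 1 = 0)
    (CM : Matrix (Fin g) (Fin g) (ZMod p))
    (hCM : ∀ i j : Fin g,
      CM i j = ((MvPolynomial.aeval ![Polynomial.X, 0, 1] h : Polynomial (ZMod p)) ^ ((p - 1) / 2)).coeff
        ((i.val + 1) * p - (j.val + 1))) (j : Fin g) :
    trq p p ((X 1 ^ 2 * X 2 ^ (2 * g - 1) - h) ^ (p - 1) *
      monomial (tri j 0 (2 * g - 2 - j)) 1) =
    ((-1) ^ ((p - 1) / 2) * ((p - 1).choose ((p - 1) / 2) : ZMod p)) •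
      ∑ i : Fin g, monomial (tri i 0 (2 * g - 2 - i)) (CM i j) := by
  have hp : p.Prime := Fact.out
  obtain ⟨k, hk⟩ := hodd
  have hk2 : (p - 1) / 2 = k := by omega
  rw [expand_f p g ⟨k, hk⟩ h hnoy _ _ _ k (by omega) (by
    rw [show 2 * k + 0 = p - 1 by omega]; exact Nat.mod_eq_of_lt (by have := hp.pos; omega))]
  rw [hk2, show p - 1 - k = k by omega]
  set α : ZMod p := (-1) ^ k * ((p - 1).choose k : ZMod p)
  set H := h ^ k with hH
  have hHy : ∀ d : Fin 3 →₀ ℕ, d 1 ≠ 0 → coeff d H = 0 := fun d hd => noy_pow p h hnoy _ d hd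
  have hHh : H.IsHomogeneous ((2 * g + 1) * k) := hhom.pow k
  have hCM' : ∀ i : Fin g, CM i j = if (i.val + 1) * p - (j.val + 1) ≤ (2 * g + 1) * k then
      coeff (tri ((i.val + 1) * p - (j.val + 1)) 0
        ((2 * g + 1) * k - ((i.val + 1) * p - (j.val + 1)))) H else 0 := by
    intro i
    rw [hCM, hk2, ← map_pow, coeff_aeval p _ _ hHh hHy]
  have hj := j.isLt
  have hlin : (2 * g - 1) * k + (2 * g - 2 - j.val) + (2 * g + 1) * k + j.val + 2 = 2 * g * p := by
    obtain ⟨c, rfl⟩ : ∃ c, g = c + 2 := ⟨g - 2, by omega⟩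
    have : 2 * (c + 2) - 2 - j.val + j.val = 2 * c + 2 := by omega
    rw [show 2 * (c + 2) - 1 = 2 * c + 3 by omega, hk]
    linear_combination this
  ext m
  rw [coeff_trq _ _ hp.pos, coeff_mul_monomial', coeff_smul, coeff_sum]
  simp only [coeff_monomial, tri_ext]
  set S := tri j (2 * k + 0) ((2 * g - 1) * k + (2 * g - 2 - j)) with hS
  have hsl : S ≤ p • m + cst (p - 1) ↔ j.val ≤ p * m 0 + (p - 1) ∧ 2 * k ≤ p * m 1 + (p - 1) ∧
      (2 * g - 1) * k + (2 * g - 2 - j) ≤ p * m 2 + (p - 1) := by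
    rw [Finsupp.le_def, Fin.forall_fin_succ, Fin.forall_fin_two]
    simp [hS]
  have hd0 : (p • m + cst (p - 1) - S) 0 = p * m 0 + (p - 1) - j := by simp [hS]
  have hd1 : (p • m + cst (p - 1) - S) 1 = p * m 1 + (p - 1) - 2 * k := by simp [hS]
  have hd2 : (p • m + cst (p - 1) - S) 2 =
      p * m 2 + (p - 1) - ((2 * g - 1) * k + (2 * g - 2 - j)) := by simp [hS]
  have hp1 := hp.two_le
  by_cases hm : m 1 = 0 ∧ m 0 + m 2 = 2 * g - 2
  · obtain ⟨hm1, hm2⟩ := hm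
    have hP : p * m 0 + p * m 2 + 2 * p = 2 * g * p := by
      have : m 0 + m 2 + 2 = 2 * g := by omega
      rw [← this]; ring
    rw [hm1, mul_zero] at hsl hd1
    have hmp : (m 0 + 1) * p = p * m 0 + p := by ring
    have hcond : S ≤ p • m + cst (p - 1) ↔ (m 0 + 1) * p - (j.val + 1) ≤ (2 * g + 1) * k := by
      rw [hsl, hmp]
      omega
    by_cases hmg : m 0 < g
    · rw [Finset.sum_eq_single ⟨m 0, hmg⟩]
      · have hcc : (⟨m 0, hmg⟩ : Fin g).val = m 0 ∧ 0 = m 1 ∧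
            2 * g - 2 - (⟨m 0, hmg⟩ : Fin g).val = m 2 := ⟨rfl, hm1.symm, by simp only; omega⟩
        rw [if_pos hcc, hCM', smul_eq_mul]
        by_cases hc : S ≤ p • m + cst (p - 1)
        · rw [if_pos hc, if_pos (hcond.1 hc), mul_comm]
          congr 2
          symm
          rw [tri_ext, hd0, hd1, hd2]
          have hc' := hcond.1 hc
          have hc'' := hsl.1 hc
          simp only
          rw [hmp] at hc' ⊢
          omega
        · rw [if_neg hc, if_neg (fun h' => hc (hcond.2 h')), mul_zero]
      · intro i _ hi
        rw [if_neg]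
        rintro ⟨h', _⟩
        exact hi (Fin.ext h')
      · simp
    · rw [Finset.sum_eq_zero, smul_zero, if_neg]
      · rw [hcond, hmp]
        have h1 : p * g ≤ p * m 0 := Nat.mul_le_mul_left _ (by omega)
        have h2 : (2 * g + 1) * k + g = p * g + k := by rw [hk]; ring
        omega
      · intro i _
        rw [if_neg]
        have := i.isLt
        omega
  · rw [Finset.sum_eq_zero, smul_zero]
    · split_ifs with hc
      · have hc'' := hsl.1 hc
        by_cases hm1 : m 1 = 0
        · rw [hHh.coeff_eq_zero, zero_mul]
          rw [deg_eq, hd0, hd1, hd2]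
          intro heq
          apply hm
          refine ⟨hm1, ?_⟩
          rw [hm1, mul_zero] at heq
          have : p * (m 0 + m 2 + 2) = p * (2 * g) := by
            rw [mul_add, mul_add, mul_comm p (2 * g)]
            omega
          have := Nat.eq_of_mul_eq_mul_left hp.pos this
          omega
        · rw [hHy, zero_mul]
          rw [hd1]
          have : 0 < p * m 1 := Nat.mul_pos hp.pos (Nat.pos_of_ne_zero hm1)
          omega
      · rfl
    · intro i _
      rw [if_neg]
      have := i.isLt
      omega

theorem case_large (p g : ℕ) [Fact p.Prime] (hodd : Odd p) (hg : 2 ≤ g) (hpg : g ≤ p)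
    (h : MvPolynomial (Fin 3) (ZMod p)) (hhom : h.IsHomogeneous (2 * g + 1))
    (hnoy : ∀ d ∈ h.support, d 1 = 0)
    (CM : Matrix (Fin g) (Fin g) (ZMod p))
    (hCM : ∀ i j : Fin g,
      CM i j = ((MvPolynomial.aeval ![Polynomial.X, 0, 1] h : Polynomial (ZMod p)) ^ ((p - 1) / 2)).coeff
        ((i.val + 1) * p - (j.val + 1)))
    (hC0 : CM ≠ 0) (hCg : CM ^ g = 0)
    (hf : (X 1 ^ 2 * X 2 ^ (2 * g - 1) - h).IsHomogeneous (2 * g + 1)) :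
    2 < level p (X 1 ^ 2 * X 2 ^ (2 * g - 1) - h) := by
  have hp : p.Prime := Fact.out
  have hp2 := hp.two_le
  have hφ := phi_w p g hodd hg hpg h hhom hnoy CM hCM
  set F : MvPolynomial (Fin 3) (ZMod p) := X 1 ^ 2 * X 2 ^ (2 * g - 1) - h with hF
  set α : ZMod p := (-1) ^ ((p - 1) / 2) * ((p - 1).choose ((p - 1) / 2) : ZMod p) with hα
  have hα0 : α ≠ 0 := by
    rw [hα]
    refine mul_ne_zero (pow_ne_zero _ (neg_ne_zero.2 one_ne_zero)) ?_
    rw [Ne, ZMod.natCast_eq_zero_iff]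
    intro hdvd
    have h1 := (Nat.choose_mul_factorial_mul_factorial (show (p - 1) / 2 ≤ p - 1 by omega))
    have h2 : p ∣ (p - 1).factorial := by
      rw [← h1, mul_assoc]
      exact Dvd.dvd.mul_right hdvd _
    rw [hp.dvd_factorial] at h2
    omega
  let L : (Fin g → ZMod p) → MvPolynomial (Fin 3) (ZMod p) :=
    fun v => ∑ i : Fin g, monomial (tri i 0 (2 * g - 2 - i)) (v i)
  have hL : ∀ v, trq p p (F ^ (p - 1) * L v) = L (α • CM.mulVec v) := by
    intro v
    have e1 : L v = ∑ j : Fin g, v j • monomial (tri j 0 (2 * g - 2 - j)) (1 : ZMod p) := by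
      simp [L, smul_monomial]
    rw [e1, Finset.mul_sum, map_sum]
    simp only [mul_smul_comm, map_smul, hφ]
    simp only [L, Matrix.mulVec, dotProduct, Pi.smul_apply, smul_eq_mul, Finset.mul_sum, map_sum,
      Finset.smul_sum, smul_monomial]
    rw [Finset.sum_comm]
    refine Finset.sum_congr rfl fun i _ => Finset.sum_congr rfl fun j _ => ?_
    congr 1
    ring
  have hL0 : ∀ v, L v = 0 → v = 0 := by
    intro v hv
    funext i
    have := congrArg (coeff (tri i 0 (2 * g - 2 - i))) hv
    rw [coeff_sum, Finset.sum_eq_single i] at this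
    · simpa using this
    · intro j _ hj
      rw [coeff_monomial, if_neg]
      rw [tri_ext]
      rintro ⟨h', _⟩
      exact hj (Fin.ext h')
    · simp
  have hiter : ∀ n v, (fun r => trq p p (F ^ (p - 1) * r))^[n] (L v) =
      L (α ^ n • (CM ^ n).mulVec v) := by
    intro n
    induction n with
    | zero => intro v; simp
    | succ n ih =>
      intro v
      rw [Function.iterate_succ_apply, hL, ih, Matrix.mulVec_smul, smul_smul, Matrix.mulVec_mulVec,
        pow_succ, pow_succ]
  obtain ⟨j, hj⟩ : ∃ j, CM.mulVec (Pi.single j 1) ≠ 0 := by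
    by_contra! hcon
    apply hC0
    ext i j
    have := congrFun (hcon j) i
    simpa using this
  refine level_core p g hg F hf (L (α • CM.mulVec (Pi.single j 1))) (L (Pi.single j 1)) ?_
    (hL _).symm ?_ g ?_
  · apply IsHomogeneous.sum
    intro i _
    apply isHomogeneous_monomial
    have := i.isLt
    rw [deg_eq]; simp; omega
  · intro h0
    have := hL0 _ h0
    exact hj ((smul_eq_zero.1 this).resolve_left hα0)
  · rw [hiter, hCg]
    simp [L]

/-- If the Cartier–Manin matrix `C` satisfies `C ≠ 0` and `C^g = 0` (i.e. the hyperelliptic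
curve `y² = h(x,1)` is supersingular but not superspecial), then the level of
`f = y²z^(2g-1) - h(x,z)` is strictly greater than `2`. -/
theorem statement9 (p : ℕ) (hp : p.Prime) (hodd : Odd p) (g : ℕ) (hg : 2 ≤ g)
    (h : MvPolynomial (Fin 3) (ZMod p)) (hhom : h.IsHomogeneous (2 * g + 1))
    (hnoy : ∀ d ∈ h.support, d 1 = 0)
    (f : MvPolynomial (Fin 3) (ZMod p)) (hf : f = X 1 ^ 2 * X 2 ^ (2 * g - 1) - h)
    (hx : Polynomial (ZMod p)) (hhx : hx = MvPolynomial.aeval ![Polynomial.X, 0, 1] h)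
    (CM : Matrix (Fin g) (Fin g) (ZMod p))
    (hCM : ∀ i j : Fin g,
      CM i j = (hx ^ ((p - 1) / 2)).coeff ((i.val + 1) * p - (j.val + 1)))
    (hC0 : CM ≠ 0) (hCg : CM ^ g = 0) :
    2 < level p f := by
  haveI : Fact p.Prime := ⟨hp⟩
  have hfh : f.IsHomogeneous (2 * g + 1) := by
    rw [hf]
    refine IsHomogeneous.sub ?_ hhom
    have := ((isHomogeneous_X (ZMod p) (1 : Fin 3)).pow 2).mul
      ((isHomogeneous_X (ZMod p) (2 : Fin 3)).pow (2 * g - 1))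
    have e : 1 * 2 + 1 * (2 * g - 1) = 2 * g + 1 := by omega
    rw [e] at this
    exact this
  subst hf
  subst hhx
  rcases le_or_gt g p with hpg | hpg
  · exact case_large p g hodd hg hpg h hhom hnoy CM hCM hC0 hCg hfh
  · exact case_small p g hodd hg h hnoy (by omega) hfh
end

section
/- Let K be a perfect field of characteristic p > 0, R = K[x_1, …, x_d], and A ∈ GL_d(K). Let φ_A : R → R be the K-algebra automorphism determined by φ_A(x_i) = Σ_j A_{i,j}·x_j. Then for every homogeneous nonzero f ∈ R and every e ≥ 0, the ideal of R generated by the φ_A-images of I_e(f) equals I_e(φ_A(f)), and likewise the ideal generated by the φ_A^(−1)-images of I_e(φ_A(f)) equals I_e(f). -/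
open MvPolynomial

theorem rootIdeal_map_le_aux {R : Type*} [CommRing R] (q : ℕ) (φ ψ : R →+* R)
    (h1 : ∀ x, ψ (φ x) = x) (h2 : ∀ x, φ (ψ x) = x) (F : R) :
    Ideal.map φ (rootIdeal q F) ≤ rootIdeal q (φ F) := by
  refine le_sInf ?_
  intro J hJ
  rw [Ideal.map_le_iff_le_comap]
  refine sInf_le ?_
  rw [Set.mem_setOf_eq] at hJ
  have h := Ideal.mem_map_of_mem ψ hJ
  rw [h1, Ideal.map_span] at h
  refine Ideal.span_mono ?_ h
  rintro _ ⟨_, ⟨a, ha, rfl⟩, rfl⟩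
  refine ⟨ψ a, ?_, ?_⟩
  · simpa [h2] using ha
  · simp

theorem rootIdeal_map_eq_aux {R : Type*} [CommRing R] (q : ℕ) (φ ψ : R →+* R)
    (h1 : ∀ x, ψ (φ x) = x) (h2 : ∀ x, φ (ψ x) = x) (F : R) :
    Ideal.map φ (rootIdeal q F) = rootIdeal q (φ F) := by
  refine le_antisymm (rootIdeal_map_le_aux q φ ψ h1 h2 F) ?_
  have h := rootIdeal_map_le_aux q ψ φ h2 h1 (φ F)
  rw [h1] at h
  have h' := Ideal.map_mono (f := φ) h
  rw [Ideal.map_map] at h'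
  have : φ.comp ψ = RingHom.id R := RingHom.ext h2
  rwa [this, Ideal.map_id] at h'

theorem linear_subst_comp_aux {K : Type*} [Field K] (d : ℕ) (A B : Matrix (Fin d) (Fin d) K)
    (hAB : A * B = 1) (x : MvPolynomial (Fin d) K) :
    (MvPolynomial.aeval fun i => ∑ j, MvPolynomial.C (B i j) * X j :
      MvPolynomial (Fin d) K →ₐ[K] MvPolynomial (Fin d) K)
    ((MvPolynomial.aeval fun i => ∑ j, MvPolynomial.C (A i j) * X j :
      MvPolynomial (Fin d) K →ₐ[K] MvPolynomial (Fin d) K) x) = x := by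
  rw [← AlgHom.comp_apply]
  conv_rhs => rw [← AlgHom.id_apply (R := K) x]
  congr 1
  refine MvPolynomial.algHom_ext fun i => ?_
  simp only [AlgHom.comp_apply, aeval_X, map_sum, map_mul, AlgHom.id_apply, algHom_C,
    MvPolynomial.algebraMap_eq, Finset.mul_sum]
  rw [Finset.sum_comm]
  have : ∀ k, ∑ j, C (A i j) * (C (B j k) * X k) =
      (C ((A * B) i k) * X k : MvPolynomial (Fin d) K) := by
    intro k
    simp [Matrix.mul_apply, Finset.sum_mul, mul_assoc]
  simp only [this, hAB, Matrix.one_apply]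
  simp

/-- For the coordinate change automorphism `φ_A` attached to `A ∈ GL_d(K)` and a nonzero
homogeneous `f`, the ideal generated by the `φ_A`-images of `I_e(f)` equals `I_e(φ_A(f))`,
and the ideal generated by the `φ_{A⁻¹}`-images of `I_e(φ_A(f))` equals `I_e(f)`. -/
theorem statement12 (p : ℕ) [Fact p.Prime] (K : Type*) [Field K] [CharP K p]
    [PerfectRing K p] (d : ℕ) (A : GL (Fin d) K)
    (φ ψ : MvPolynomial (Fin d) K →ₐ[K] MvPolynomial (Fin d) K)
    (hφ : φ = MvPolynomial.aeval fun i =>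
      ∑ j, MvPolynomial.C ((A : Matrix (Fin d) (Fin d) K) i j) * X j)
    (hψ : ψ = MvPolynomial.aeval fun i =>
      ∑ j, MvPolynomial.C (((A⁻¹ : GL (Fin d) K) : Matrix (Fin d) (Fin d) K) i j) * X j)
    (f : MvPolynomial (Fin d) K) (hf0 : f ≠ 0) (n : ℕ) (hfhom : f.IsHomogeneous n)
    (e : ℕ) :
    Ideal.map φ (rootIdeal (p ^ e) f) = rootIdeal (p ^ e) (φ f) ∧
    Ideal.map ψ (rootIdeal (p ^ e) (φ f)) = rootIdeal (p ^ e) f := by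
  have h1 : ∀ x, ψ (φ x) = x := by
    intro x
    rw [hφ, hψ]
    exact linear_subst_comp_aux d _ _ (by simp) x
  have h2 : ∀ x, φ (ψ x) = x := by
    intro x
    rw [hφ, hψ]
    exact linear_subst_comp_aux d _ _ (by simp) x
  refine ⟨rootIdeal_map_eq_aux (p ^ e) φ.toRingHom ψ.toRingHom h1 h2 f, ?_⟩
  have h := rootIdeal_map_eq_aux (p ^ e) ψ.toRingHom φ.toRingHom h2 h1 (φ f)
  have h3 : ψ.toRingHom (φ f) = f := h1 f
  rw [h3] at h
  exact h
end

section
/- Let p be an odd prime, g ≥ 2 an integer, and μ ∈ F_p nonzero. If p ≡ 2g+1 (mod 4g), then the coefficient c_{p−g−1} of x^(p−g−1) in (x^(2g+1) + μx)^((p−1)/2) ∈ F_p[x] is nonzero. -/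
open MvPolynomial

/-- If `p ≡ 2g+1 (mod 4g)`, the coefficient `c_{p-g-1}` of `x^(p-g-1)` in
`(x^(2g+1) + μx)^((p-1)/2)` over `F_p` is nonzero. -/
theorem statement15 (p : ℕ) (hp : p.Prime) (hodd : Odd p) (g : ℕ) (hg : 2 ≤ g)
    (μ : ZMod p) (hμ : μ ≠ 0) (hcong : p ≡ 2 * g + 1 [MOD 4 * g]) :
    ((Polynomial.X ^ (2 * g + 1) + Polynomial.C μ * Polynomial.X : Polynomial (ZMod p)) ^
        ((p - 1) / 2)).coeff (p - g - 1) ≠ 0 := by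
  have : Fact p.Prime := ⟨hp⟩
  have hmod : p % (4 * g) = 2 * g + 1 := by
    have h : p % (4 * g) = (2 * g + 1) % (4 * g) := hcong
    rw [h, Nat.mod_eq_of_lt (by omega)]
  obtain ⟨k, hk⟩ : ∃ k, p = 2 * g + 1 + 4 * (g * k) :=
    ⟨p / (4 * g), by
      have h := Nat.mod_add_div p (4 * g)
      rw [hmod] at h
      linarith [mul_assoc 4 g (p / (4 * g))]⟩
  have hn : (p - 1) / 2 = g + 2 * (g * k) := by omega
  have hc : p - g - 1 = k * (2 * g) + (g + 2 * (g * k)) := by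
    have : k * (2 * g) = 2 * (g * k) := by ring
    omega
  have hkn : k ≤ g + 2 * (g * k) := by nlinarith [Nat.zero_le k]
  have hnp : g + 2 * (g * k) < p := by omega
  rw [hn, hc]
  generalize g + 2 * (g * k) = n at *
  have hpoly : ((Polynomial.X ^ (2 * g + 1) + Polynomial.C μ * Polynomial.X :
      Polynomial (ZMod p)) ^ n) =
      Polynomial.expand (ZMod p) (2 * g) ((Polynomial.X + Polynomial.C μ) ^ n)
        * Polynomial.X ^ n := by
    rw [map_pow, ← mul_pow, map_add, Polynomial.expand_X, Polynomial.expand_C]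
    ring
  rw [hpoly, Polynomial.coeff_mul_X_pow, Polynomial.coeff_expand_mul (by omega),
    Polynomial.coeff_X_add_C_pow]
  refine mul_ne_zero (pow_ne_zero _ hμ) ?_
  rw [Ne, ZMod.natCast_eq_zero_iff]
  intro hd
  have h1 : p ∣ n.factorial := by
    rw [← Nat.choose_mul_factorial_mul_factorial hkn, mul_assoc]
    exact Dvd.dvd.mul_right hd _
  have := (hp.dvd_factorial).1 h1
  omega
end

section
/- Let p be an odd prime, g ≥ 2 an integer, and μ ∈ F_p nonzero. If p ≡ −1 (mod 4g), then the coefficient c_{gp−g−1} of x^(gp−g−1) in (x^(2g+1) + μx)^((p−1)/2) ∈ F_p[x] is nonzero. -/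
open MvPolynomial

/-- If `p ≡ -1 (mod 4g)`, the coefficient `c_{gp-g-1}` of `x^(gp-g-1)` in
`(x^(2g+1) + μx)^((p-1)/2)` over `F_p` is nonzero. -/
theorem statement16 (p : ℕ) (hp : p.Prime) (hodd : Odd p) (g : ℕ) (hg : 2 ≤ g)
    (μ : ZMod p) (hμ : μ ≠ 0) (hcong : (p : ℤ) ≡ -1 [ZMOD (4 * g : ℕ)]) :
    ((Polynomial.X ^ (2 * g + 1) + Polynomial.C μ * Polynomial.X : Polynomial (ZMod p)) ^
        ((p - 1) / 2)).coeff (g * p - g - 1) ≠ 0 := by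
  haveI : Fact p.Prime := ⟨hp⟩
  have h1 : (4 * g) ∣ p + 1 := by
    have h := hcong.symm.dvd
    rw [sub_neg_eq_add] at h
    exact_mod_cast h
  obtain ⟨m, hm⟩ := h1
  have hm0 : 1 ≤ m := by
    rcases Nat.eq_zero_or_pos m with h | h
    · subst h; simp at hm
    · exact h
  obtain ⟨n, hn⟩ : ∃ n, n + 1 = 2 * (g * m) := by
    have : 1 ≤ g * m := Nat.mul_pos (by omega) hm0
    exact ⟨2 * (g * m) - 1, by omega⟩
  have hm' : p + 1 = 4 * (g * m) := by rw [hm]; ring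
  have hpn : p = 2 * n + 1 := by omega
  have hmn : m ≤ n := by
    have : 2 * m ≤ g * m := Nat.mul_le_mul_right m hg
    omega
  obtain ⟨k, hk⟩ := Nat.exists_eq_add_of_le hmn
  have hhalf : (p - 1) / 2 = n := by omega
  have hexp : g * p - g - 1 = k * (2 * g) + n := by
    have e1 : g * p = 2 * (g * n) + g := by rw [hpn]; ring
    have e2 : g * n = g * m + g * k := by rw [hk]; ring
    have e3 : k * (2 * g) = 2 * (g * k) := by ring
    omega
  have hpoly : (Polynomial.X ^ (2 * g + 1) + Polynomial.C μ * Polynomial.X :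
      Polynomial (ZMod p)) ^ n =
      Polynomial.expand (ZMod p) (2 * g) ((Polynomial.X + Polynomial.C μ) ^ n)
        * Polynomial.X ^ n := by
    rw [map_pow, ← mul_pow]
    congr 1
    simp only [map_add, Polynomial.expand_X, Polynomial.expand_C]
    ring
  rw [hhalf, hexp, hpoly, Polynomial.coeff_mul_X_pow,
    Polynomial.coeff_expand_mul (by omega), Polynomial.coeff_X_add_C_pow]
  refine mul_ne_zero (pow_ne_zero _ hμ) ?_
  rw [Ne, ZMod.natCast_eq_zero_iff]
  intro hd
  have h2 : p ∣ n.factorial := by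
    rw [← Nat.choose_mul_factorial_mul_factorial (show k ≤ n by omega), mul_assoc]
    exact hd.mul_right _
  have := (hp.dvd_factorial).1 h2
  omega
end

section
/- Let p be an odd prime, g ≥ 2 an integer, and μ ∈ F_p nonzero, and suppose p ≡ 2g+1 (mod 4g) or p ≡ −1 (mod 4g) (so that, by Valentini's theorem, the hyperelliptic curve y² = x^(2g+1) + μx is superspecial). Then the level of the polynomial f = y²·z^(2g−1) − x^(2g+1) − μ·x·z^(2g) ∈ F_p[x,y,z] is strictly greater than 2. -/
open MvPolynomial

namespace S17

open Finset

/-- quotient of exponents -/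
noncomputable def dv (q : ℕ) (n : Fin 3 →₀ ℕ) : Fin 3 →₀ ℕ :=
  n.mapRange (fun a => a / q) (Nat.zero_div q)

lemma dv_apply (q : ℕ) (n : Fin 3 →₀ ℕ) (i : Fin 3) : dv q n i = n i / q := by
  simp [dv]

open Classical in
/-- coordinate of `F` along the monomial `e` in the basis over `q`-th powers -/
noncomputable def phi (p q : ℕ) (e : Fin 3 → ℕ) :
    MvPolynomial (Fin 3) (ZMod p) →ₗ[ZMod p] MvPolynomial (Fin 3) (ZMod p) :=
  (basisMonomials (Fin 3) (ZMod p)).constr (ZMod p)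
    (fun n => if ∀ i, n i % q = e i then monomial (dv q n) 1 else 0)

open Classical in
lemma phi_monomial (p q : ℕ) (e : Fin 3 → ℕ) (n : Fin 3 →₀ ℕ) (c : ZMod p) :
    phi p q e (monomial n c) = if ∀ i, n i % q = e i then monomial (dv q n) c else 0 := by
  have h : (monomial n c : MvPolynomial (Fin 3) (ZMod p))
      = c • basisMonomials (Fin 3) (ZMod p) n := by
    simp [smul_monomial]
  rw [h, map_smul, phi, Module.Basis.constr_basis]
  split_ifs <;> simp [smul_monomial]

lemma phi_expand (p q : ℕ) (hq : 0 < q) (e : Fin 3 → ℕ) (a b : MvPolynomial (Fin 3) (ZMod p)) :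
    phi p q e (b * expand q a) = phi p q e b * a := by
  classical
  induction a using MvPolynomial.induction_on' with
  | add a1 a2 h1 h2 => simp [mul_add, h1, h2]
  | monomial m c =>
    induction b using MvPolynomial.induction_on' with
    | add b1 b2 h1 h2 => simp only [add_mul, map_add, h1, h2]
    | monomial n d =>
      rw [expand_monomial, monomial_mul, phi_monomial, phi_monomial]
      have h1 : ∀ i, (n + q • m) i % q = n i % q := by intro i; simp
      simp only [h1]
      split_ifs
      · rw [monomial_mul]
        congr 2
        ext i
        simp [dv_apply, Nat.add_mul_div_left _ _ hq]
      · simp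

lemma recon (p q : ℕ) (hq : 0 < q) (F : MvPolynomial (Fin 3) (ZMod p)) :
    F = ∑ e ∈ Fintype.piFinset (fun _ : Fin 3 => range q),
      monomial (Finsupp.equivFunOnFinite.symm e) 1 * expand q (phi p q e F) := by
  classical
  induction F using MvPolynomial.induction_on' with
  | add a1 a2 h1 h2 =>
    conv_lhs => rw [h1, h2]
    simp [mul_add, sum_add_distrib]
  | monomial n c =>
    rw [sum_eq_single (fun i => n i % q)]
    · rw [phi_monomial, if_pos (fun _ => rfl), expand_monomial, monomial_mul]
      congr 1
      · congr 1
        ext i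
        simp [dv_apply, Nat.mod_add_div]
      · simp
    · intro e _ he
      rw [phi_monomial, if_neg]
      · simp
      · intro h
        exact he (funext fun i => (h i).symm)
    · intro h
      exfalso
      apply h
      simp [Nat.mod_lt _ hq]

lemma pow_eq_expand (p : ℕ) [Fact p.Prime] (s : ℕ) (a : MvPolynomial (Fin 3) (ZMod p)) :
    a ^ (p ^ s) = expand (p ^ s) a := by
  induction s with
  | zero => simp
  | succ s ih => rw [pow_succ, pow_mul, ih, mul_comm, expand_mul, expand_zmod]

lemma phi_mem (p : ℕ) [hp : Fact p.Prime] (s : ℕ) (e : Fin 3 → ℕ)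
    (F : MvPolynomial (Fin 3) (ZMod p)) (J : Ideal (MvPolynomial (Fin 3) (ZMod p)))
    (h : F ∈ Ideal.span ((fun a => a ^ (p ^ s)) '' (J : Set (MvPolynomial (Fin 3) (ZMod p))))) :
    phi p (p ^ s) e F ∈ J := by
  have hq : 0 < p ^ s := pow_pos hp.out.pos s
  induction h using Submodule.span_induction generalizing e with
  | mem x hx =>
    obtain ⟨a, ha, rfl⟩ := hx
    have := phi_expand p (p ^ s) hq e a 1
    rw [one_mul, ← pow_eq_expand] at this
    simp only [this]
    exact J.mul_mem_left _ ha
  | zero => simp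
  | add x y _ _ hx hy => rw [map_add]; exact J.add_mem (hx e) (hy e)
  | smul r x hx0 hx =>
    rw [recon p (p ^ s) hq x, smul_eq_mul, mul_sum, map_sum]
    refine J.sum_mem fun e' _ => ?_
    rw [← mul_assoc, phi_expand _ _ hq]
    exact J.mul_mem_left _ (hx e')

lemma rootIdeal_eq (p : ℕ) [hp : Fact p.Prime] (s : ℕ) (F : MvPolynomial (Fin 3) (ZMod p)) :
    rootIdeal (p ^ s) F = Ideal.span (Set.range fun e => phi p (p ^ s) e F) := by
  have hq : 0 < p ^ s := pow_pos hp.out.pos s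
  apply le_antisymm
  · apply sInf_le
    rw [Set.mem_ofPred_eq]
    have h := recon p (p ^ s) hq F
    generalize hI : Ideal.span (Set.range fun e => phi p (p ^ s) e F) = I
    have hI' : ∀ e, phi p (p ^ s) e F ∈ I := fun e => hI ▸ Ideal.subset_span ⟨e, rfl⟩
    rw [h]
    refine Ideal.sum_mem _ fun e _ => Ideal.mul_mem_left _ _ ?_
    rw [← pow_eq_expand]
    exact Ideal.subset_span ⟨_, hI' e, rfl⟩
  · apply le_sInf
    intro J hJ
    rw [Ideal.span_le]
    rintro _ ⟨e, rfl⟩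
    exact phi_mem p s e F J hJ

lemma phi_degree (p q d : ℕ) (hq : 0 < q) (e : Fin 3 → ℕ) (F : MvPolynomial (Fin 3) (ZMod p))
    (h : F.totalDegree ≤ q * d) : phi p q e F ∈ restrictTotalDegree (Fin 3) (ZMod p) d := by
  classical
  rw [F.as_sum, map_sum]
  refine Submodule.sum_mem _ fun n hn => ?_
  rw [phi_monomial]
  split_ifs
  · rw [mem_restrictTotalDegree]
    refine (totalDegree_monomial_le _ _).trans ?_
    have h1 := (le_totalDegree hn).trans h
    rw [Finsupp.sum_fintype _ _ (fun _ => rfl)] at h1 ⊢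
    refine Nat.le_of_mul_le_mul_left (le_trans ?_ h1) hq
    rw [mul_sum]
    refine sum_le_sum fun i _ => ?_
    rw [dv_apply]
    exact Nat.mul_div_le _ _
  · exact Submodule.zero_mem _

/-- the chain of ideals -/
noncomputable def ch (p : ℕ) (f : MvPolynomial (Fin 3) (ZMod p)) (s : ℕ) :
    Ideal (MvPolynomial (Fin 3) (ZMod p)) := rootIdeal (p ^ s) (f ^ (p ^ s - 1))

lemma ch_anti (p : ℕ) [hp : Fact p.Prime] (f : MvPolynomial (Fin 3) (ZMod p)) (s : ℕ) :
    ch p f (s + 1) ≤ ch p f s := by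
  apply le_sInf
  intro J hJ
  apply sInf_le
  rw [Set.mem_ofPred_eq] at hJ ⊢
  have h0 : 0 < p ^ s := pow_pos hp.out.pos s
  have h1 : p ^ (s + 1) - 1 = (p ^ s - 1) * p + (p - 1) := by
    have := hp.out.pos
    rw [pow_succ, Nat.sub_mul, one_mul]
    have : p ≤ p ^ s * p := Nat.le_mul_of_pos_left _ h0
    omega
  rw [h1, pow_add f, pow_mul f]
  refine Ideal.mul_mem_right _ _ ?_
  generalize f ^ (p ^ s - 1) = F at hJ
  induction hJ using Submodule.span_induction with
  | mem x hx =>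
    obtain ⟨a, ha, rfl⟩ := hx
    refine Ideal.subset_span ⟨a, ha, ?_⟩
    simp only [← pow_mul, pow_succ]
  | zero => simp [hp.out.ne_zero]
  | add x y _ _ hx hy =>
    rw [add_pow_char]
    exact Ideal.add_mem _ hx hy
  | smul r x hx0 hx =>
    rw [smul_eq_mul, mul_pow]
    exact Ideal.mul_mem_left _ _ hx

lemma ch_stab (p : ℕ) [hp : Fact p.Prime] (f : MvPolynomial (Fin 3) (ZMod p)) :
    ∃ s, ch p f s = ch p f (s + 1) := by
  by_contra! hne
  have hs : StrictAnti (ch p f) :=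
    strictAnti_nat_of_succ_lt fun n => lt_of_le_of_ne (ch_anti p f n) (hne n).symm
  set d := f.totalDegree with hd
  have hfin : (restrictTotalDegree (Fin 3) (ZMod p) d :
      Set (MvPolynomial (Fin 3) (ZMod p))).Finite := by
    have : Finite (restrictTotalDegree (Fin 3) (ZMod p) d) :=
      Module.finite_of_finite (ZMod p)
    exact Set.toFinite _
  have hr : Set.range (ch p f) ⊆ Ideal.span '' (restrictTotalDegree (Fin 3) (ZMod p) d :
      Set (MvPolynomial (Fin 3) (ZMod p))).powerset := by
    rintro _ ⟨s, rfl⟩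
    refine ⟨Set.range fun e => phi p (p ^ s) e (f ^ (p ^ s - 1)), ?_, (rootIdeal_eq p s _).symm⟩
    rintro _ ⟨e, rfl⟩
    refine phi_degree p _ d (pow_pos hp.out.pos s) e _ ?_
    refine (totalDegree_pow _ _).trans ?_
    exact Nat.mul_le_mul_right _ (Nat.sub_le _ _)
  exact Set.infinite_range_of_injective hs.injective ((hfin.finite_subsets.image _).subset hr)

/-- exponents of the monomials of the powers of `f` -/
noncomputable def E (g i j k : ℕ) : Fin 3 →₀ ℕ :=
  Finsupp.single 0 ((2 * g + 1) * j + k) + Finsupp.single 1 (2 * i) +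
    Finsupp.single 2 ((2 * g - 1) * i + 2 * g * k)

lemma E0 (g i j k : ℕ) : E g i j k 0 = (2 * g + 1) * j + k := by simp [E]
lemma E1 (g i j k : ℕ) : E g i j k 1 = 2 * i := by simp [E]
lemma E2 (g i j k : ℕ) : E g i j k 2 = (2 * g - 1) * i + 2 * g * k := by simp [E]

/-- coefficients of the powers of `f` -/
noncomputable def cf (p : ℕ) (μ : ZMod p) (N i j : ℕ) : ZMod p :=
  (-1) ^ j * (-μ) ^ (N - i - j) * ((N - i).choose j) * (N.choose i)

lemma monE (p g : ℕ) (μ : ZMod p) (i j k : ℕ) (r : ZMod p) :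
    (X 1 ^ 2 * X 2 ^ (2 * g - 1) : MvPolynomial (Fin 3) (ZMod p)) ^ i *
      ((-(X 0 ^ (2 * g + 1))) ^ j * (-(C μ * X 0 * X 2 ^ (2 * g))) ^ k) * C r
     = monomial (E g i j k) ((-1) ^ j * (-μ) ^ k * r) := by
  have h : (monomial (E g i j k) ((-1) ^ j * (-μ) ^ k * r) : MvPolynomial (Fin 3) (ZMod p))
    = C ((-1) ^ j * (-μ) ^ k * r) * (X 0 ^ ((2 * g + 1) * j + k) * X 1 ^ (2 * i) *
      X 2 ^ ((2 * g - 1) * i + 2 * g * k)) := by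
    rw [X_pow_eq_monomial, X_pow_eq_monomial, X_pow_eq_monomial, monomial_mul, monomial_mul,
      C_mul_monomial]
    simp [E]
  rw [h]
  simp only [C_mul, C_pow, C_neg, C_1]
  generalize (C μ : MvPolynomial (Fin 3) (ZMod p)) = cm
  generalize (X 0 : MvPolynomial (Fin 3) (ZMod p)) = x
  generalize (X 2 : MvPolynomial (Fin 3) (ZMod p)) = z
  rw [neg_pow (x ^ (2 * g + 1)), neg_pow (cm * x * z ^ (2 * g)), neg_pow cm]
  simp only [mul_pow, ← pow_mul, pow_add]
  ring

lemma f_pow (p g : ℕ) (μ : ZMod p) (f : MvPolynomial (Fin 3) (ZMod p))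
    (hf : f = X 1 ^ 2 * X 2 ^ (2 * g - 1) - X 0 ^ (2 * g + 1) -
      MvPolynomial.C μ * X 0 * X 2 ^ (2 * g)) (N : ℕ) :
    f ^ N = ∑ i ∈ range (N + 1), ∑ j ∈ range (N - i + 1),
      monomial (E g i j (N - i - j)) (cf p μ N i j) := by
  have : f = X 1 ^ 2 * X 2 ^ (2 * g - 1) +
      (-(X 0 ^ (2 * g + 1)) + -(C μ * X 0 * X 2 ^ (2 * g))) := by rw [hf]; ring
  rw [this, add_pow]
  refine sum_congr rfl fun i _ => ?_
  rw [add_pow, mul_sum, sum_mul]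
  refine sum_congr rfl fun j _ => ?_
  rw [cf, mul_assoc (_ * _), ← monE, C_mul]
  simp only [map_natCast]
  ring

lemma cf_ne (p : ℕ) [hp : Fact p.Prime] (μ : ZMod p) (hμ : μ ≠ 0) (i j : ℕ)
    (hij : i + j ≤ p - 1) : cf p μ (p - 1) i j ≠ 0 := by
  have key : ∀ n k : ℕ, n ≤ p - 1 → k ≤ n → ((n.choose k : ℕ) : ZMod p) ≠ 0 := by
    intro n k hn hk h
    rw [ZMod.natCast_eq_zero_iff] at h
    have h2 : p ∣ n.factorial := by
      rw [← Nat.choose_mul_factorial_mul_factorial hk]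
      exact Dvd.dvd.mul_right (Dvd.dvd.mul_right h _) _
    rw [hp.out.dvd_factorial] at h2
    have := hp.out.pos
    omega
  unfold cf
  have h1 := key (p - 1 - i) j (by omega) (by omega)
  have h2 := key (p - 1) i le_rfl (by omega)
  have h3 : (-μ) ^ (p - 1 - i - j) ≠ 0 := pow_ne_zero _ (neg_ne_zero.mpr hμ)
  have h4 : (-1 : ZMod p) ^ j ≠ 0 := pow_ne_zero _ (neg_ne_zero.mpr one_ne_zero)
  exact mul_ne_zero (mul_ne_zero (mul_ne_zero h4 h3) h1) h2

lemma uniq (p g : ℕ) (h2 : Nat.Coprime p 2) (hg : Nat.Coprime p (2 * g)) (hp : 0 < p)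
    (i j i' j' : ℕ)
    (h : i + j ≤ p - 1) (h' : i' + j' ≤ p - 1)
    (he : ∀ t, E g i j (p - 1 - i - j) t % p = E g i' j' (p - 1 - i' - j') t % p) :
    i = i' ∧ j = j' := by
  have e0 := he 0
  have e1 := he 1
  rw [E0, E0] at e0
  rw [E1, E1] at e1
  have hi : i = i' := by
    have : i ≡ i' [MOD p] := Nat.ModEq.cancel_left_of_coprime h2 e1
    exact Nat.ModEq.eq_of_lt_of_lt this (by omega) (by omega)
  subst hi
  refine ⟨rfl, ?_⟩
  have a1 : (2 * g + 1) * j + (p - 1 - i - j) = 2 * g * j + (p - 1 - i) := by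
    rw [add_mul]; omega
  have a2 : (2 * g + 1) * j' + (p - 1 - i - j') = 2 * g * j' + (p - 1 - i) := by
    rw [add_mul]; omega
  rw [a1, a2] at e0
  have : j ≡ j' [MOD p] :=
    Nat.ModEq.cancel_left_of_coprime hg (Nat.ModEq.add_right_cancel' _ e0)
  exact Nat.ModEq.eq_of_lt_of_lt this (by omega) (by omega)

lemma phi_f (p g : ℕ) (h2 : Nat.Coprime p 2) (hg : Nat.Coprime p (2 * g)) (hp : 0 < p)
    (μ : ZMod p) (f : MvPolynomial (Fin 3) (ZMod p))
    (hf : f = X 1 ^ 2 * X 2 ^ (2 * g - 1) - X 0 ^ (2 * g + 1) -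
      MvPolynomial.C μ * X 0 * X 2 ^ (2 * g))
    (i j : ℕ) (hij : i + j ≤ p - 1) :
    phi p p (fun t => E g i j (p - 1 - i - j) t % p) (f ^ (p - 1)) =
      monomial (dv p (E g i j (p - 1 - i - j))) (cf p μ (p - 1) i j) := by
  classical
  rw [f_pow p g μ f hf, map_sum, sum_eq_single i]
  · rw [map_sum, sum_eq_single j]
    · rw [phi_monomial, if_pos (fun _ => rfl)]
    · intro j' hj' hne
      rw [phi_monomial, if_neg]
      intro h
      rw [mem_range] at hj'
      exact hne (uniq p g h2 hg hp i j' i j (by omega) hij h).2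
    · intro h
      exact absurd (mem_range.mpr (by omega)) h
  · intro i' hi' hne
    rw [map_sum]
    refine sum_eq_zero fun j' hj' => ?_
    rw [phi_monomial, if_neg]
    intro h
    rw [mem_range] at hj' hi'
    exact hne (uniq p g h2 hg hp i' j' i j (by omega) hij h).1
  · intro h
    exact absurd (mem_range.mpr (by omega)) h

/-- the test ideal -/
noncomputable def Jac (p a c : ℕ) : Ideal (MvPolynomial (Fin 3) (ZMod p)) :=
  Ideal.span ((fun n => monomial n (1 : ZMod p)) ''
    {Finsupp.single 0 (a + 1), Finsupp.single 1 1, Finsupp.single 2 (c + 1)})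

lemma not_mem_Jac (p a c : ℕ) (n : Fin 3 →₀ ℕ) (r : ZMod p) (hr : r ≠ 0) (h0 : n 0 ≤ a)
    (h1 : n 1 = 0) (h2 : n 2 ≤ c) : monomial n r ∉ Jac p a c := by
  classical
  intro h
  rw [Jac, mem_ideal_span_monomial_image] at h
  obtain ⟨m, hm, hle⟩ := h n (by rw [support_monomial, if_neg hr]; simp)
  rcases hm with rfl | rfl | rfl
  · have := hle 0; simp at this; omega
  · have := hle 1; simp at this; omega
  · have := hle 2; simp at this; omega

lemma mono_mem (p a c q : ℕ) (n : Fin 3 →₀ ℕ) (r : ZMod p)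
    (h : q * (a + 1) ≤ n 0 ∨ q ≤ n 1 ∨ q * (c + 1) ≤ n 2) :
    monomial n r ∈ Ideal.span ((fun x => x ^ q) ''
      (Jac p a c : Set (MvPolynomial (Fin 3) (ZMod p)))) := by
  have key : ∀ m : Fin 3 →₀ ℕ, m ∈ ({Finsupp.single 0 (a + 1), Finsupp.single 1 1,
      Finsupp.single 2 (c + 1)} : Set (Fin 3 →₀ ℕ)) → q • m ≤ n →
      monomial n r ∈ Ideal.span ((fun x => x ^ q) ''
      (Jac p a c : Set (MvPolynomial (Fin 3) (ZMod p)))) := by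
    intro m hm hle
    have : (monomial n r : MvPolynomial (Fin 3) (ZMod p))
        = monomial (n - q • m) r * (monomial m 1) ^ q := by
      rw [monomial_pow, monomial_mul, tsub_add_cancel_of_le hle]; simp
    rw [this]
    exact Ideal.mul_mem_left _ _ (Ideal.subset_span ⟨_, Ideal.subset_span ⟨m, hm, rfl⟩, rfl⟩)
  rcases h with h | h | h
  · refine key _ (Or.inl rfl) ?_
    rw [Finsupp.smul_single, Finsupp.single_le_iff]; simpa using h
  · refine key _ (Or.inr (Or.inl rfl)) ?_
    rw [Finsupp.smul_single, Finsupp.single_le_iff]; simpa using h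
  · refine key _ (Or.inr (Or.inr rfl)) ?_
    rw [Finsupp.smul_single, Finsupp.single_le_iff]; simpa using h

lemma ch1_le (p g a c : ℕ) (μ : ZMod p) (f : MvPolynomial (Fin 3) (ZMod p))
    (hf : f = X 1 ^ 2 * X 2 ^ (2 * g - 1) - X 0 ^ (2 * g + 1) -
      MvPolynomial.C μ * X 0 * X 2 ^ (2 * g))
    (h : ∀ i j k, i + j + k = p - 1 → p * (a + 1) ≤ E g i j k 0 ∨ p ≤ E g i j k 1 ∨
      p * (c + 1) ≤ E g i j k 2) : ch p f 1 ≤ Jac p a c := by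
  apply sInf_le
  rw [Set.mem_ofPred_eq, pow_one, f_pow p g μ f hf]
  refine Ideal.sum_mem _ fun i hi => Ideal.sum_mem _ fun j hj => mono_mem _ _ _ _ _ _ ?_
  rw [mem_range] at hi hj
  exact h _ _ _ (by omega)

lemma ch2_le (p g a c : ℕ) [hp : Fact p.Prime] (μ : ZMod p) (f : MvPolynomial (Fin 3) (ZMod p))
    (hf : f = X 1 ^ 2 * X 2 ^ (2 * g - 1) - X 0 ^ (2 * g + 1) -
      MvPolynomial.C μ * X 0 * X 2 ^ (2 * g))
    (h : ∀ i j k i' j' k', i + j + k = p - 1 → i' + j' + k' = p - 1 →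
      p ^ 2 * (a + 1) ≤ E g i j k 0 + p * E g i' j' k' 0 ∨
      p ^ 2 ≤ E g i j k 1 + p * E g i' j' k' 1 ∨
      p ^ 2 * (c + 1) ≤ E g i j k 2 + p * E g i' j' k' 2) : ch p f 2 ≤ Jac p a c := by
  apply sInf_le
  have h1 : p ^ 2 - 1 = (p - 1) + (p - 1) * p := by
    obtain ⟨n, hn⟩ : ∃ n, p = n + 1 := ⟨p - 1, by have := hp.out.pos; omega⟩
    rw [hn]
    simp only [Nat.add_sub_cancel]
    have : (n + 1) ^ 2 = n + n * (n + 1) + 1 := by ring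
    omega
  rw [Set.mem_ofPred_eq, h1, pow_add, pow_mul, ← expand_zmod, f_pow p g μ f hf]
  simp only [map_sum, sum_mul, mul_sum, expand_monomial, monomial_mul]
  refine Ideal.sum_mem _ fun i hi => Ideal.sum_mem _ fun j hj => Ideal.sum_mem _ fun i' hi' =>
    Ideal.sum_mem _ fun j' hj' => mono_mem _ _ _ _ _ _ ?_
  rw [mem_range] at hi hj hi' hj'
  simp only [Finsupp.add_apply, Finsupp.smul_apply, smul_eq_mul]
  exact h _ _ _ _ _ _ (by omega) (by omega)

lemma level_gt (p : ℕ) [hp : Fact p.Prime] (f : MvPolynomial (Fin 3) (ZMod p))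
    (h1 : ch p f 1 ≠ ⊤) (h2 : ch p f 1 ≠ ch p f 2) : 2 < level p f := by
  have hne : {s : ℕ | 1 ≤ s ∧ rootIdeal (p ^ (s - 1)) (f ^ (p ^ (s - 1) - 1)) =
      rootIdeal (p ^ s) (f ^ (p ^ s - 1))}.Nonempty := by
    obtain ⟨s, hs⟩ := ch_stab p f
    exact ⟨s + 1, by omega, hs⟩
  have hmem := Nat.sInf_mem hne
  change level p f ∈ _ at hmem
  generalize level p f = s at hmem
  obtain ⟨hs1, hs⟩ := hmem
  change ch p f (s - 1) = ch p f s at hs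
  by_contra hlt
  have : s = 1 ∨ s = 2 := by omega
  rcases this with rfl | rfl
  · apply h1
    rw [← hs, eq_top_iff]
    refine le_sInf fun J hJ => ?_
    simp only [Set.mem_ofPred_eq] at hJ
    simp at hJ
    exact ((Ideal.eq_top_iff_one _).mpr hJ).ge
  · exact h2 hs

lemma main_aux (p g : ℕ) [hp : Fact p.Prime] (h2 : Nat.Coprime p 2)
    (hg : Nat.Coprime p (2 * g)) (hg2 : 2 ≤ g)
    (μ : ZMod p) (hμ : μ ≠ 0) (f : MvPolynomial (Fin 3) (ZMod p))
    (hf : f = X 1 ^ 2 * X 2 ^ (2 * g - 1) - X 0 ^ (2 * g + 1) -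
      MvPolynomial.C μ * X 0 * X 2 ^ (2 * g)) (a c : ℕ)
    (h : ∀ i j k i' j' k', i + j + k = p - 1 → i' + j' + k' = p - 1 →
      p ^ 2 * (a + 1) ≤ E g i j k 0 + p * E g i' j' k' 0 ∨
      p ^ 2 ≤ E g i j k 1 + p * E g i' j' k' 1 ∨
      p ^ 2 * (c + 1) ≤ E g i j k 2 + p * E g i' j' k' 2)
    (i j k : ℕ) (hijk : i + j + k = p - 1) (b0 : E g i j k 0 < p * (a + 1))
    (b1 : E g i j k 1 < p) (b2 : E g i j k 2 < p * (c + 1)) : 2 < level p f := by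
  have hpos := hp.out.pos
  apply level_gt
  · intro htop
    have hle := ch1_le p g 0 0 μ f hf (by
      intro i j k hs
      rw [E0, E1, E2]
      by_contra! hc
      obtain ⟨c0, c1, c2⟩ := hc
      obtain ⟨t, rfl⟩ : ∃ t, g = t + 2 := ⟨g - 2, by omega⟩
      have e : 2 * (t + 2) - 1 = 2 * t + 3 := by omega
      rw [e] at c2
      have : p = i + j + k + 1 := by omega
      have hp2 := hp.out.two_le
      rw [this] at c0 c1 c2 hp2
      nlinarith [mul_nonneg (Nat.zero_le t) (Nat.zero_le i),
        mul_nonneg (Nat.zero_le t) (Nat.zero_le j), mul_nonneg (Nat.zero_le t) (Nat.zero_le k)])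
    rw [htop] at hle
    refine not_mem_Jac p 0 0 0 1 one_ne_zero (by simp) (by simp) (by simp) (hle trivial)
  · intro heq
    have hle := ch2_le p g a c μ f hf h
    rw [← heq] at hle
    have hk : k = p - 1 - i - j := by omega
    subst hk
    have hm : phi p p (fun t => E g i j (p - 1 - i - j) t % p) (f ^ (p - 1)) ∈ ch p f 1 := by
      have := rootIdeal_eq p 1 (f ^ (p - 1))
      rw [pow_one] at this
      rw [ch, pow_one, this]
      exact Ideal.subset_span ⟨_, rfl⟩
    rw [phi_f p g h2 hg hpos μ f hf i j (by omega)] at hm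
    refine not_mem_Jac p a c _ _ (cf_ne p μ hμ i j (by omega)) ?_ ?_ ?_ (hle hm)
    · rw [dv_apply]; exact Nat.lt_succ_iff.mp (Nat.div_lt_of_lt_mul b0)
    · rw [dv_apply]; exact Nat.div_eq_of_lt b1
    · rw [dv_apply]; exact Nat.lt_succ_iff.mp (Nat.div_lt_of_lt_mul b2)

lemma common (g h a i0 j0 k0 i1 j1 k1 : ℤ) (hg : 2 ≤ g) (hh : g ≤ h)
    (p0 : 0 ≤ i0) (p1 : 0 ≤ i1) (q0 : 0 ≤ j0) (q1 : 0 ≤ j1) (r0 : 0 ≤ k0) (r1 : 0 ≤ k1)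
    (s0 : i0 + j0 + k0 = 2 * h) (s1 : i1 + j1 + k1 = 2 * h)
    (hA : ((2 * g + 1) * j0 + k0) + (2 * h + 1) * ((2 * g + 1) * j1 + k1)
      < (2 * h + 1) ^ 2 * (a + 1))
    (hB : 2 * i0 + (2 * h + 1) * (2 * i1) < (2 * h + 1) ^ 2)
    (hC : ((2 * g - 1) * i0 + 2 * g * k0) + (2 * h + 1) * ((2 * g - 1) * i1 + 2 * g * k1)
      < (2 * h + 1) ^ 2 * (2 * g - 1 - a)) :
    ∃ d e : ℤ, 0 ≤ d ∧ 0 ≤ e ∧ e + 2 * d ≤ 2 * g - 2 ∧ j0 ≤ h + d ∧ j1 ≤ h ∧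
      e + d = (2 * h + 1) ^ 2 * (a + 1) - 1 - 2 * g * j0 - h - (2 * h + 1) * (2 * g * j1 + h) := by
  have hk0 : k0 = 2 * h - i0 - j0 := by linarith
  have hk1 : k1 = 2 * h - i1 - j1 := by linarith
  subst hk0 hk1
  have u1 : i1 ≤ h := by
    by_contra! hc
    nlinarith
  have u2 : h ≤ i1 := by
    by_contra! hc
    nlinarith
  have u3 : i1 = h := le_antisymm u1 u2
  subst u3
  have u4 : i0 ≤ i1 := by nlinarith
  refine ⟨i1 - i0, (2 * i1 + 1) ^ 2 * (a + 1) - 1 - 2 * g * j0 - i1 -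
    (2 * i1 + 1) * (2 * g * j1 + i1) - (i1 - i0), by linarith, ?_, ?_, by linarith, by linarith,
    by ring⟩
  · nlinarith
  · nlinarith

lemma zero_of_mul (g T r : ℤ) (hg : 0 < g) (h0 : -g < g * T) (h1 : g * T < g) : T = 0 := by
  have : -1 < T := by nlinarith
  have : T < 1 := by nlinarith
  omega

lemma arith1 (g m h i0 j0 k0 i1 j1 k1 : ℤ) (hg : 2 ≤ g) (hm : 0 ≤ m) (hh : h = g * (2 * m + 1))
    (p0 : 0 ≤ i0) (p1 : 0 ≤ i1) (q0 : 0 ≤ j0) (q1 : 0 ≤ j1) (r0 : 0 ≤ k0) (r1 : 0 ≤ k1)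
    (s0 : i0 + j0 + k0 = 2 * h) (s1 : i1 + j1 + k1 = 2 * h)
    (hA : ((2 * g + 1) * j0 + k0) + (2 * h + 1) * ((2 * g + 1) * j1 + k1)
      < (2 * h + 1) ^ 2 * (0 + 1))
    (hB : 2 * i0 + (2 * h + 1) * (2 * i1) < (2 * h + 1) ^ 2)
    (hC : ((2 * g - 1) * i0 + 2 * g * k0) + (2 * h + 1) * ((2 * g - 1) * i1 + 2 * g * k1)
      < (2 * h + 1) ^ 2 * (2 * g - 1 - 0)) : False := by
  obtain ⟨d, e, hd, he, hde, hj0, hj1, heq⟩ := common g h 0 i0 j0 k0 i1 j1 k1 hg (by nlinarith)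
    p0 p1 q0 q1 r0 r1 s0 s1 hA hB hC
  have h3 : e + d = (2 * g) * ((2 * m + 1) * (h + 1) - j0 - (2 * h + 1) * j1) := by
    rw [heq]; linear_combination (2 * h + 2) * hh
  have hT := zero_of_mul (2 * g) _ 0 (by linarith) (by rw [← h3]; linarith) (by rw [← h3]; linarith)
  rw [hT, mul_zero] at h3
  have hd0 : d = 0 := by linarith
  subst hd0
  have hmh : 2 * m + 1 < h := by nlinarith
  have : m ≤ j1 := by
    by_contra! hc
    nlinarith
  have : j1 ≤ m := by
    by_contra! hc
    nlinarith
  have : j1 = m := by omega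
  subst this
  nlinarith

lemma arith2 (g m h i0 j0 k0 i1 j1 k1 : ℤ) (hg : 2 ≤ g) (hm : 1 ≤ m) (hh : h = 2 * g * m - 1)
    (hex : 3 * m < h)
    (p0 : 0 ≤ i0) (p1 : 0 ≤ i1) (q0 : 0 ≤ j0) (q1 : 0 ≤ j1) (r0 : 0 ≤ k0) (r1 : 0 ≤ k1)
    (s0 : i0 + j0 + k0 = 2 * h) (s1 : i1 + j1 + k1 = 2 * h)
    (hA : ((2 * g + 1) * j0 + k0) + (2 * h + 1) * ((2 * g + 1) * j1 + k1)
      < (2 * h + 1) ^ 2 * (1 + 1))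
    (hB : 2 * i0 + (2 * h + 1) * (2 * i1) < (2 * h + 1) ^ 2)
    (hC : ((2 * g - 1) * i0 + 2 * g * k0) + (2 * h + 1) * ((2 * g - 1) * i1 + 2 * g * k1)
      < (2 * h + 1) ^ 2 * (2 * g - 1 - 1)) : False := by
  obtain ⟨d, e, hd, he, hde, hj0, hj1, heq⟩ := common g h 1 i0 j0 k0 i1 j1 k1 hg (by nlinarith)
    p0 p1 q0 q1 r0 r1 s0 s1 hA hB hC
  have h3 : e + d - 1 = (2 * g) * (6 * h * m - j0 - (2 * h + 1) * j1) := by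
    rw [heq]; linear_combination (6 * h) * hh
  have hT := zero_of_mul (2 * g) _ 0 (by linarith) (by rw [← h3]; linarith) (by rw [← h3]; linarith)
  rw [hT, mul_zero] at h3
  have hd0 : d ≤ 1 := by linarith
  have : 3 * m - 1 < j1 := by
    by_contra! hc
    nlinarith
  nlinarith

lemma ex7 (i j k i' j' k' : ℕ) (h : i + j + k = 6) (h' : i' + j' + k' = 6)
    (hA : (2 * 2 + 1) * j + k + 7 * ((2 * 2 + 1) * j' + k') < 7 ^ 2 * (2 + 1))
    (hB : 2 * i + 7 * (2 * i') < 7 ^ 2)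
    (hC : (2 * 2 - 1) * i + 2 * 2 * k + 7 * ((2 * 2 - 1) * i' + 2 * 2 * k') < 7 ^ 2 * (0 + 1)) :
    False := by
  omega

end S17

theorem statement17 (p : ℕ) (hp : p.Prime) (hodd : Odd p) (g : ℕ) (hg : 2 ≤ g)
    (μ : ZMod p) (hμ : μ ≠ 0)
    (hcong : p ≡ 2 * g + 1 [MOD 4 * g] ∨ (p : ℤ) ≡ -1 [ZMOD (4 * g : ℕ)])
    (f : MvPolynomial (Fin 3) (ZMod p))
    (hf : f = X 1 ^ 2 * X 2 ^ (2 * g - 1) - X 0 ^ (2 * g + 1) -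
      MvPolynomial.C μ * X 0 * X 2 ^ (2 * g)) :
    2 < level p f := by
  haveI : Fact p.Prime := ⟨hp⟩
  have h2 : Nat.Coprime p 2 := hodd.coprime_two_right
  have hcop : 2 * g < p → Nat.Coprime p (2 * g) := fun h =>
    (Nat.Prime.coprime_iff_not_dvd hp).mpr fun hd => by
      have := Nat.le_of_dvd (by omega) hd
      omega
  have hcast : ((2 * g - 1 : ℕ) : ℤ) = 2 * g - 1 := by omega
  rcases hcong with hc | hc
  · obtain ⟨m, hm⟩ : ∃ m, p = 2 * (g * (2 * m + 1)) + 1 := by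
      have h4 : (2 * g + 1) % (4 * g) = 2 * g + 1 := Nat.mod_eq_of_lt (by omega)
      have h5 : p % (4 * g) = 2 * g + 1 := by rw [← h4]; exact hc
      refine ⟨p / (4 * g), ?_⟩
      have := Nat.div_add_mod p (4 * g)
      rw [h5] at this
      rw [← this]
      have h6 : (4 * g * (p / (4 * g)) + (2 * g + 1)) = p := this
      rw [h6]
      linarith
    have hlt : 2 * g < p := by rw [hm]; nlinarith [Nat.zero_le (g * m)]
    have hkk : m ≤ g * (2 * m + 1) := by nlinarith [Nat.zero_le (g * m)]
    refine S17.main_aux p g h2 (hcop hlt) hg μ hμ f hf 0 (2 * g - 2) ?_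
      (g * (2 * m + 1)) m (g * (2 * m + 1) - m) (by omega) ?_ ?_ ?_
    · intro i j k i' j' k' hs hs'
      rw [S17.E0, S17.E1, S17.E2, S17.E0, S17.E1, S17.E2]
      by_contra! hcc
      obtain ⟨hA, hB, hC⟩ := hcc
      zify at hA hB hC
      have hc2 : ((2 * g - 2 : ℕ) : ℤ) = 2 * g - 2 := by omega
      have hpz : (p : ℤ) = 2 * (g * (2 * m + 1)) + 1 := by exact_mod_cast hm
      rw [hcast, hc2] at hC
      rw [hpz] at hA hB hC
      have hs2 : i + j + k = 2 * (g * (2 * m + 1)) := by omega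
      have hs3 : i' + j' + k' = 2 * (g * (2 * m + 1)) := by omega
      zify at hs2 hs3
      refine S17.arith1 g m (g * (2 * m + 1)) i j k i' j' k' (by exact_mod_cast hg) (by positivity)
        rfl (by positivity) (by positivity) (by positivity) (by positivity) (by positivity)
        (by positivity) hs2 hs3 hA hB ?_
      linarith
    · rw [S17.E0]
      zify [hkk]
      zify at hm hg
      rw [hm]
      nlinarith
    · rw [S17.E1]; omega
    · rw [S17.E2]
      have hc2 : ((2 * g - 2 : ℕ) : ℤ) = 2 * g - 2 := by omega
      zify [hkk]
      rw [hcast, hc2]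
      zify at hm hg
      rw [hm]
      nlinarith
  · obtain ⟨m, hm1, hm⟩ : ∃ m : ℕ, 1 ≤ m ∧ p + 1 = 4 * g * m := by
      have h1 : ((4 * g : ℕ) : ℤ) ∣ ((p + 1 : ℕ) : ℤ) := by
        have := hc.symm.dvd
        push_cast at this ⊢
        simpa using this
      rw [Int.natCast_dvd_natCast] at h1
      obtain ⟨m, hm⟩ := h1
      refine ⟨m, ?_, hm⟩
      rcases Nat.eq_zero_or_pos m with h | h
      · subst h; simp at hm
      · exact h
    have hgm : g ≤ g * m := Nat.le_mul_of_pos_right _ hm1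
    have hmg : 2 * m ≤ g * m := Nat.mul_le_mul_right _ hg
    have hm' : p = 2 * (2 * (g * m) - 1) + 1 := by
      have : 4 * g * m = 4 * (g * m) := by ring
      omega
    have hlt : 2 * g < p := by omega
    by_cases hex : 3 * m < 2 * (g * m) - 1
    · refine S17.main_aux p g h2 (hcop hlt) hg μ hμ f hf 1 (2 * g - 3) ?_
        (2 * (g * m) - 1) (3 * m - 1) (2 * (g * m) - 3 * m) (by omega) ?_ ?_ ?_
      · intro i j k i' j' k' hs hs'
        rw [S17.E0, S17.E1, S17.E2, S17.E0, S17.E1, S17.E2]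
        by_contra! hcc
        obtain ⟨hA, hB, hC⟩ := hcc
        zify at hA hB hC
        have hc2 : ((2 * g - 3 : ℕ) : ℤ) = 2 * g - 3 := by omega
        have hpz : (p : ℤ) = 2 * (2 * g * m - 1) + 1 := by
          zify at hm; linarith
        rw [hcast, hc2] at hC
        rw [hpz] at hA hB hC
        have hs2 : (i + j + k : ℤ) = 2 * (2 * g * m - 1) := by
          have := hp.pos
          have : i + j + k + 1 = p := by omega
          zify at this; linarith
        have hs3 : (i' + j' + k' : ℤ) = 2 * (2 * g * m - 1) := by
          have := hp.pos
          have : i' + j' + k' + 1 = p := by omega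
          zify at this; linarith
        refine S17.arith2 g m (2 * g * m - 1) i j k i' j' k' (by exact_mod_cast hg)
          (by exact_mod_cast hm1) rfl ?_ (by positivity) (by positivity) (by positivity)
          (by positivity) (by positivity)
          (by positivity) hs2 hs3 hA hB ?_
        · have : 3 * m + 1 < 2 * (g * m) := by omega
          zify at this; linarith
        · linarith
      · rw [S17.E0]
        have e1 : 3 * m ≤ 2 * (g * m) := by omega
        have e2 : 1 ≤ 3 * m := by omega
        zify [e1, e2]
        zify at hm hg
        nlinarith
      · rw [S17.E1]; omega
      · rw [S17.E2]
        have e1 : 3 * m ≤ 2 * (g * m) := by omega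
        have e2 : 1 ≤ 2 * (g * m) := by omega
        have hc2 : ((2 * g - 3 : ℕ) : ℤ) = 2 * g - 3 := by omega
        zify [e1, e2]
        rw [hcast, hc2]
        have hpz : (p : ℤ) = 4 * g * m - 1 := by
          zify at hm; linarith
        zify at hg
        rw [hpz]
        nlinarith
    · have hg2 : g = 2 := by
        by_contra hne
        have : 3 * m ≤ g * m := Nat.mul_le_mul_right _ (by omega)
        omega
      subst hg2
      have hm2 : m = 1 := by omega
      subst hm2
      have hp7 : p = 7 := by omega
      subst hp7
      refine S17.main_aux 7 2 h2 (hcop hlt) hg μ hμ f hf 2 0 ?_ 2 4 0 (by omega) ?_ ?_ ?_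
      · intro i j k i' j' k' hs hs'
        rw [S17.E0, S17.E1, S17.E2, S17.E0, S17.E1, S17.E2]
        by_contra! hcc
        obtain ⟨hA, hB, hC⟩ := hcc
        exact S17.ex7 i j k i' j' k' hs hs' hA hB hC
      · rw [S17.E0]; norm_num
      · rw [S17.E1]; norm_num
      · rw [S17.E2]; norm_num
end

section
/- For the polynomial f = y²z³ − x⁵ − 2z⁵ ∈ F_11[x,y,z] (a quintic defining the genus-2 hyperelliptic curve y² = x⁵ + 2, which is ordinary over F_11), the chain of ideals of p^e-th roots is F_11[x,y,z] ⊋ I_1(f^10) = (z², xz, x³) = I_2(f^(11²−1)); in particular the level of f is 2. -/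
open MvPolynomial

abbrev RR := MvPolynomial (Fin 3) (ZMod 11)

noncomputable def vv (i j k : ℕ) : Fin 3 →₀ ℕ := Finsupp.equivFunOnFinite.symm ![i, j, k]

@[simp] lemma vv0 (i j k : ℕ) : vv i j k 0 = i := rfl
@[simp] lemma vv1 (i j k : ℕ) : vv i j k 1 = j := rfl
@[simp] lemma vv2 (i j k : ℕ) : vv i j k 2 = k := rfl

lemma vv_add (i j k i' j' k' : ℕ) : vv i j k + vv i' j' k' = vv (i + i') (j + j') (k + k') := by
  ext t; fin_cases t <;> rfl

lemma vv_self (n : Fin 3 →₀ ℕ) : vv (n 0) (n 1) (n 2) = n := by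
  ext t; fin_cases t <;> rfl

lemma mono_eq (i j k : ℕ) (c : ZMod 11) :
    (monomial (vv i j k) c : RR) = C c * (X 0 ^ i * X 1 ^ j * X 2 ^ k) := by
  rw [monomial_eq, Finsupp.prod_fintype _ _ (by simp), Fin.prod_univ_three]
  simp

noncomputable def pr (r0 r1 r2 : ℕ) : RR →ₗ[ZMod 11] RR :=
  (basisMonomials (Fin 3) (ZMod 11)).constr (ZMod 11) (fun n =>
    if n 0 % 11 = r0 ∧ n 1 % 11 = r1 ∧ n 2 % 11 = r2 then
      monomial (vv (n 0 / 11) (n 1 / 11) (n 2 / 11)) 1 else 0)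

lemma pr_mono (r0 r1 r2 : ℕ) (n : Fin 3 →₀ ℕ) (c : ZMod 11) :
    pr r0 r1 r2 (monomial n c) = if n 0 % 11 = r0 ∧ n 1 % 11 = r1 ∧ n 2 % 11 = r2 then
      monomial (vv (n 0 / 11) (n 1 / 11) (n 2 / 11)) c else 0 := by
  have h : (monomial n c : RR) = c • (basisMonomials (Fin 3) (ZMod 11)) n := by
    simp [smul_monomial]
  rw [h, map_smul, pr, Module.Basis.constr_basis]
  split_ifs <;> simp [smul_monomial]

lemma pr_mul (r0 r1 r2 : ℕ) (a b : RR) : pr r0 r1 r2 (a ^ 11 * b) = a * pr r0 r1 r2 b := by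
  have : Fact (Nat.Prime 11) := ⟨by norm_num⟩
  induction a using MvPolynomial.induction_on' with
  | add p q hp hq => rw [add_pow_char, add_mul, map_add, hp, hq, add_mul]
  | monomial m c =>
    induction b using MvPolynomial.induction_on' with
    | add p q hp hq => rw [mul_add, map_add, hp, hq, map_add, mul_add]
    | monomial n d =>
      have hc : c ^ 11 = c := ZMod.pow_card c
      rw [monomial_pow, monomial_mul, pr_mono, pr_mono, hc]
      have e : ∀ t, (11 • m + n) t = 11 * m t + n t := fun t => by simp
      simp only [e, Nat.mul_add_mod, Nat.mul_add_div (show 11 > 0 by norm_num)]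
      split_ifs
      · rw [monomial_mul, ← vv_add, vv_self]
      · simp

noncomputable def fr (q : ℕ) (J : Ideal RR) : Ideal RR := Ideal.span ((fun a => a ^ q) '' (J : Set RR))

lemma pr_mem (r0 r1 r2 : ℕ) (J : Ideal RR) (F : RR) (h : F ∈ fr 11 J) :
    pr r0 r1 r2 F ∈ J := by
  unfold fr at h
  induction h using Submodule.span_induction with
  | zero => simp
  | add x y _ _ hx hy => rw [map_add]; exact J.add_mem hx hy
  | mem x hx =>
    obtain ⟨a, ha, rfl⟩ := hx
    have := pr_mul r0 r1 r2 a 1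
    rw [mul_one] at this
    simp only [this]
    exact J.mul_mem_right _ ha
  | smul b x hx' hx =>
    clear hx
    induction hx' using Submodule.span_induction generalizing b with
    | zero => simp
    | add x y _ _ hx hy => rw [smul_add, map_add]; exact J.add_mem (hx b) (hy b)
    | mem x hx =>
      obtain ⟨a, ha, rfl⟩ := hx
      simp only [smul_eq_mul]
      rw [mul_comm, pr_mul]
      exact J.mul_mem_right _ ha
    | smul d x _ hx => rw [smul_smul]; exact hx _

lemma fr_fr (J : Ideal RR) : fr (11 ^ 2) J ≤ fr 11 (fr 11 J) := by
  unfold fr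
  rw [Ideal.span_le]
  rintro _ ⟨a, ha, rfl⟩
  refine Ideal.subset_span ⟨a ^ 11, Ideal.subset_span ⟨a, ha, rfl⟩, ?_⟩
  simp only [← pow_mul]; norm_num

noncomputable def ff : RR := X 1 ^ 2 * X 2 ^ 3 - X 0 ^ 5 - MvPolynomial.C 2 * X 2 ^ 5

lemma ff_pow : ff ^ 10 = ∑ a ∈ Finset.range 11, ∑ b ∈ Finset.range (10 - a + 1),
    monomial (vv (5 * a) (2 * b) (3 * b + 5 * (10 - a - b)))
      ((-1) ^ a * (Nat.choose 10 a) * (Nat.choose (10 - a) b) * (-2) ^ (10 - a - b) : ZMod 11) := by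
  have h : ff = -(X 0 ^ 5) + (X 1 ^ 2 * X 2 ^ 3 + C (-2) * X 2 ^ 5) := by
    rw [ff, map_neg]; ring
  rw [h, add_pow]
  refine Finset.sum_congr rfl fun a ha => ?_
  rw [add_pow, Finset.mul_sum, Finset.sum_mul]
  refine Finset.sum_congr rfl fun b hb => ?_
  rw [mono_eq, neg_pow]
  simp only [map_mul, map_pow, map_natCast, map_neg, map_one]
  ring

noncomputable def JJ : Ideal RR := Ideal.span {X 2 ^ 2, X 0 * X 2, X 0 ^ 3}

lemma term_mem (q A B D : ℕ) (c : ZMod 11)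
    (h : 3 * q ≤ A ∨ (q ≤ A ∧ q ≤ D) ∨ 2 * q ≤ D) : (monomial (vv A B D) c : RR) ∈ fr q JJ := by
  have key : ∀ g ∈ ({X 2 ^ 2, X 0 * X 2, X 0 ^ 3} : Set RR), ∀ F u : RR,
      F = u * g ^ q → F ∈ fr q JJ := by
    rintro g hg F u rfl
    exact Ideal.mul_mem_left _ _ (Ideal.subset_span ⟨g, Ideal.subset_span hg, rfl⟩)
  rcases h with h | ⟨h1, h2⟩ | h
  · obtain ⟨A, rfl⟩ := Nat.exists_eq_add_of_le h
    refine key (X 0 ^ 3) (by simp) _ (monomial (vv A B D) c) ?_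
    rw [mono_eq, mono_eq]; ring
  · obtain ⟨A, rfl⟩ := Nat.exists_eq_add_of_le h1
    obtain ⟨D, rfl⟩ := Nat.exists_eq_add_of_le h2
    refine key (X 0 * X 2) (by simp) _ (monomial (vv A B D) c) ?_
    rw [mono_eq, mono_eq]; ring
  · obtain ⟨D, rfl⟩ := Nat.exists_eq_add_of_le h
    refine key (X 2 ^ 2) (by simp) _ (monomial (vv A B D) c) ?_
    rw [mono_eq, mono_eq]; ring

lemma ff_mem : ff ^ 10 ∈ fr 11 JJ := by
  rw [ff_pow]
  refine Ideal.sum_mem _ fun a ha => Ideal.sum_mem _ fun b hb => term_mem _ _ _ _ _ ?_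
  simp only [Finset.mem_range] at ha hb
  omega

lemma fr_pow (J : Ideal RR) (F : RR) (h : F ∈ fr 11 J) : F ^ 11 ∈ fr (11 ^ 2) J := by
  have : Fact (Nat.Prime 11) := ⟨by norm_num⟩
  unfold fr at h
  induction h using Submodule.span_induction with
  | zero => simp
  | add x y _ _ hx hy => rw [add_pow_char]; exact Ideal.add_mem _ hx hy
  | mem x hx =>
    obtain ⟨a, ha, rfl⟩ := hx
    refine Ideal.subset_span ⟨a, ha, ?_⟩
    simp only [← pow_mul]; norm_num
  | smul b x _ hx => rw [smul_eq_mul, mul_pow]; exact Ideal.mul_mem_left _ _ hx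

lemma ff_mem2 : ff ^ 120 ∈ fr (11 ^ 2) JJ := by
  have : ff ^ 120 = ff ^ 10 * (ff ^ 10) ^ 11 := by rw [← pow_mul, ← pow_add]
  rw [this]
  exact Ideal.mul_mem_left _ _ (fr_pow _ _ ff_mem)

lemma pr_ff (i j k a0 b0 : ℕ) (ha : a0 ≤ 10) (hb : b0 ≤ 10 - a0) :
    ∃ c : ZMod 11, c ≠ 0 ∧
    pr ((5 * a0 + i) % 11) ((2 * b0 + j) % 11) ((3 * b0 + 5 * (10 - a0 - b0) + k) % 11)
      (ff ^ 10 * monomial (vv i j k) 1) =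
    monomial (vv ((5 * a0 + i) / 11) ((2 * b0 + j) / 11)
      ((3 * b0 + 5 * (10 - a0 - b0) + k) / 11)) c := by
  refine ⟨((-1) ^ a0 * (Nat.choose 10 a0) * (Nat.choose (10 - a0) b0) *
    (-2) ^ (10 - a0 - b0) : ZMod 11), ?_, ?_⟩
  · interval_cases a0 <;> simp only [Nat.reduceSub] at hb <;> interval_cases b0 <;> decide
  · rw [ff_pow, Finset.sum_mul, map_sum]
    rw [Finset.sum_eq_single a0]
    · rw [Finset.sum_mul, map_sum, Finset.sum_eq_single b0]
      · rw [monomial_mul, vv_add, pr_mono]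
        simp
      · intro b hb' hne
        simp only [Finset.mem_range] at hb'
        rw [monomial_mul, vv_add, pr_mono, if_neg]
        simp only [vv0, vv1, vv2]
        omega
      · intro h; simp only [Finset.mem_range] at h; omega
    · intro a ha' hne
      simp only [Finset.mem_range] at ha'
      rw [Finset.sum_mul, map_sum]
      refine Finset.sum_eq_zero fun b hb' => ?_
      rw [monomial_mul, vv_add, pr_mono, if_neg]
      simp only [vv0, vv1, vv2]
      omega
    · intro h; simp only [Finset.mem_range] at h; omega

lemma mem_of_mono (J : Ideal RR) (i j k : ℕ) (c : ZMod 11) (hc : c ≠ 0)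
    (h : (monomial (vv i j k) c : RR) ∈ J) : (monomial (vv i j k) 1 : RR) ∈ J := by
  have : Fact (Nat.Prime 11) := ⟨by norm_num⟩
  have := J.mul_mem_left (C c⁻¹) h
  rwa [C_mul_monomial, inv_mul_cancel₀ hc] at this

lemma step (J : Ideal RR) (i j k a0 b0 : ℕ) (ha : a0 ≤ 10) (hb : b0 ≤ 10 - a0)
    (h : ff ^ 10 * monomial (vv i j k) 1 ∈ fr 11 J) :
    (monomial (vv ((5 * a0 + i) / 11) ((2 * b0 + j) / 11)
      ((3 * b0 + 5 * (10 - a0 - b0) + k) / 11)) 1 : RR) ∈ J := by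
  obtain ⟨c, hc, e⟩ := pr_ff i j k a0 b0 ha hb
  refine mem_of_mono _ _ _ _ c hc ?_
  rw [← e]
  exact pr_mem _ _ _ _ _ h

lemma step2 (J : Ideal RR) (a0 b0 : ℕ) (ha : a0 ≤ 10) (hb : b0 ≤ 10 - a0)
    (h : ff ^ 120 ∈ fr (11 ^ 2) J) :
    (ff ^ 10 * monomial (vv ((5 * a0) / 11) ((2 * b0) / 11)
      ((3 * b0 + 5 * (10 - a0 - b0)) / 11)) 1 : RR) ∈ fr 11 J := by
  have : Fact (Nat.Prime 11) := ⟨by norm_num⟩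
  have e0 : ff ^ 120 = (ff ^ 10) ^ 11 * (ff ^ 10 * monomial (vv 0 0 0) 1) := by
    rw [mono_eq]; simp only [map_one, pow_zero, mul_one]; rw [← pow_mul, ← pow_add]
  obtain ⟨c, hc, e⟩ := pr_ff 0 0 0 a0 b0 ha hb
  have h2 := pr_mem ((5 * a0 + 0) % 11) ((2 * b0 + 0) % 11)
    ((3 * b0 + 5 * (10 - a0 - b0) + 0) % 11) _ _ (fr_fr J h)
  rw [e0, pr_mul, e] at h2
  have := (fr 11 J).mul_mem_left (C c⁻¹) h2
  rwa [mul_left_comm, C_mul_monomial, inv_mul_cancel₀ hc] at this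

lemma JJ_le (J : Ideal RR) (h1 : (monomial (vv 0 0 2) 1 : RR) ∈ J)
    (h2 : (monomial (vv 1 0 1) 1 : RR) ∈ J) (h3 : (monomial (vv 3 0 0) 1 : RR) ∈ J) : JJ ≤ J := by
  rw [mono_eq] at h1 h2 h3
  simp only [map_one, pow_zero, pow_one, one_mul, mul_one] at h1 h2 h3
  unfold JJ
  rw [Ideal.span_le]
  rintro g (rfl | rfl | rfl) <;> assumption

lemma root1 : rootIdeal 11 (ff ^ 10) = JJ := by
  refine le_antisymm (sInf_le ff_mem) (le_sInf fun J hJ => ?_)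
  have hJ' : ff ^ 10 * monomial (vv 0 0 0) 1 ∈ fr 11 J := by
    have e : (monomial (vv 0 0 0) 1 : RR) = 1 := by rw [mono_eq]; simp
    rw [e, mul_one]; exact hJ
  exact JJ_le J (step J 0 0 0 2 5 (by norm_num) (by norm_num) hJ')
    (step J 0 0 0 4 5 (by norm_num) (by norm_num) hJ')
    (step J 0 0 0 7 3 (by norm_num) (by norm_num) hJ')

lemma root2 : rootIdeal (11 ^ 2) (ff ^ 120) = JJ := by
  refine le_antisymm (sInf_le ff_mem2) (le_sInf fun J hJ => ?_)
  exact JJ_le J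
    (step J 0 0 2 2 5 (by norm_num) (by norm_num) (step2 J 2 5 (by norm_num) (by norm_num) hJ))
    (step J 1 0 1 4 5 (by norm_num) (by norm_num) (step2 J 4 5 (by norm_num) (by norm_num) hJ))
    (step J 3 0 0 7 3 (by norm_num) (by norm_num) (step2 J 7 3 (by norm_num) (by norm_num) hJ))

lemma JJ_ne : JJ ≠ ⊤ := by
  have : Fact (Nat.Prime 11) := ⟨by norm_num⟩
  intro h
  have hle : JJ ≤ RingHom.ker (constantCoeff : RR →+* ZMod 11) := by
    unfold JJ
    rw [Ideal.span_le]
    rintro g (rfl | rfl | rfl) <;> simp [RingHom.mem_ker]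
  have h1 : (1 : RR) ∈ JJ := by rw [h]; trivial
  have := hle h1
  simp [RingHom.mem_ker] at this

lemma root0 : rootIdeal 1 (1 : RR) = ⊤ := by
  refine eq_top_iff.2 (le_sInf fun J hJ => ?_)
  simp only [Set.mem_ofPred_eq, pow_one, Set.image_id', Ideal.span_eq] at hJ
  rw [(Ideal.eq_top_iff_one J).2 hJ]

lemma level2 : level 11 ff = 2 := by
  have hmem : 2 ∈ {s : ℕ | 1 ≤ s ∧
    rootIdeal (11 ^ (s - 1)) (ff ^ (11 ^ (s - 1) - 1)) =
      rootIdeal (11 ^ s) (ff ^ (11 ^ s - 1))} := by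
    refine ⟨by norm_num, ?_⟩
    exact root1.trans root2.symm
  refine le_antisymm (Nat.sInf_le hmem) (le_csInf ⟨2, hmem⟩ ?_)
  rintro s ⟨hs, h⟩
  by_contra hlt
  obtain rfl : s = 1 := by omega
  apply JJ_ne
  rw [← root1, ← root0]
  simpa using h.symm

/-- For `f = y²z³ - x⁵ - 2z⁵` over `F₁₁` (the ordinary genus-2 curve `y² = x⁵ + 2`),
the chain of ideals of `p^e`-th roots is
`F₁₁[x,y,z] ⊋ I_1(f^10) = (z², xz, x³) = I_2(f^120)`; in particular the level is `2`. -/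
theorem statement18 (f : MvPolynomial (Fin 3) (ZMod 11))
    (hf : f = X 1 ^ 2 * X 2 ^ 3 - X 0 ^ 5 - MvPolynomial.C 2 * X 2 ^ 5) :
    rootIdeal 11 (f ^ 10) ≠ ⊤ ∧
    rootIdeal 11 (f ^ 10) =
      Ideal.span {X 2 ^ 2, X 0 * X 2, X 0 ^ 3} ∧
    rootIdeal (11 ^ 2) (f ^ (11 ^ 2 - 1)) =
      Ideal.span {X 2 ^ 2, X 0 * X 2, X 0 ^ 3} ∧
    level 11 f = 2 := by
  obtain rfl : f = ff := hf
  exact ⟨root1 ▸ JJ_ne, root1, root2, level2⟩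
end
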